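/- arXiv:1608.01827 — 10 statements merged into one kernel-verified Lean document; each statement's English description precedes it below -/
import Mathlib

section
/- For every k ∈ {1,…,N−1} and every b ∈ {0,1}^k, W_k(b) = (1/2)·W_{k+1}(b,0) + (1/2)·max{W_{k+1}(b,0), W_{k+1}(b,1) + Q_{k+1}}; moreover W_0 = (1/2)·W_1(0) + (1/2)·max{W_1(0), W_1(1) + Q_1}. -/
open Finset

/-- The social welfare `Ψ(b) = Σ_{t<T} f_t(Σ_{n<N} b_n X_n^t) + Σ_{n<N} b_n Q_n`
(0-based indices; only the first `N` entries of `b` matter). -/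
noncomputable def Psi (T N : ℕ) (f : ℕ → ℝ → ℝ) (X : ℕ → ℕ → ℝ) (Q : ℕ → ℝ)
    (b : ℕ → Bool) : ℝ :=
  (∑ t ∈ range T, f t (∑ n ∈ range N, if b n then X n t else 0)) +
    ∑ n ∈ range N, (if b n then Q n else 0)

/-- `BP T N f X Q j = (B, S)` where, for a prefix `b` of length `k = N - j`,
`B b = B^k_N(b)` is the full outcome vector obtained by extending `b` with the
Nash bargaining solutions `b*_m` of steps `m = k,…,N-1`, and
`S b = Σ_{m=k}^{N-1} π*_m(B^k_m(b))` is the total payoff of the remaining VOs.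
Step `m`'s NBS is `b*_m(β) = 1`, `π*_m(β) = Δ*_m(β)/2` if `Δ*_m(β) ≥ 0` and
`b*_m(β) = 0`, `π*_m(β) = 0` otherwise, where
`Δ*_m(β) = [Ψ(B^{m+1}_N(β,1)) − Σ π*] − [Ψ(B^{m+1}_N(β,0)) − Σ π*]`. -/
noncomputable def BP (T N : ℕ) (f : ℕ → ℝ → ℝ) (X : ℕ → ℕ → ℝ) (Q : ℕ → ℝ) :
    ℕ → ((ℕ → Bool) → (ℕ → Bool)) × ((ℕ → Bool) → ℝ)
  | 0 => (fun b => b, fun _ => 0)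
  | j + 1 =>
      let prev := BP T N f X Q j
      let k := N - (j + 1)
      let val : (ℕ → Bool) → ℝ := fun b => Psi T N f X Q (prev.1 b) - prev.2 b
      let delta : (ℕ → Bool) → ℝ := fun b =>
        val (Function.update b k true) - val (Function.update b k false)
      (fun b => prev.1 (Function.update b k (if 0 ≤ delta b then true else false)),
       fun b => (if 0 ≤ delta b then delta b / 2 else 0) +
         prev.2 (Function.update b k (if 0 ≤ delta b then true else false)))

/-- `W_k(b) = Ψ(B^k_N(b)) − Σ_{n<k} b_n Q_n − Σ_{m=k}^{N-1} π*_m(B^k_m(b))`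
(0-based prefix `b` of length `k`). -/
noncomputable def Wseq (T N : ℕ) (f : ℕ → ℝ → ℝ) (X : ℕ → ℕ → ℝ) (Q : ℕ → ℝ)
    (k : ℕ) (b : ℕ → Bool) : ℝ :=
  Psi T N f X Q ((BP T N f X Q (N - k)).1 b)
    - (∑ n ∈ range k, if b n then Q n else 0)
    - (BP T N f X Q (N - k)).2 b

/-- `Δ*_k(b)` for the (0-based) step `k`, prefix `b` of length `k`. -/
noncomputable def DeltaSeq (T N : ℕ) (f : ℕ → ℝ → ℝ) (X : ℕ → ℕ → ℝ) (Q : ℕ → ℝ)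
    (k : ℕ) (b : ℕ → Bool) : ℝ :=
  (Psi T N f X Q ((BP T N f X Q (N - (k + 1))).1 (Function.update b k true))
      - (BP T N f X Q (N - (k + 1))).2 (Function.update b k true))
    - (Psi T N f X Q ((BP T N f X Q (N - (k + 1))).1 (Function.update b k false))
      - (BP T N f X Q (N - (k + 1))).2 (Function.update b k false))

/-- `W_0 = W_1(b*_1) + b*_1·Q_1 − π*_1`, where `b*_1, π*_1` are computed at the
empty prefix; this equals the MNO's eventual payoff `U_0`. -/
noncomputable def W0seq (T N : ℕ) (f : ℕ → ℝ → ℝ) (X : ℕ → ℕ → ℝ) (Q : ℕ → ℝ) : ℝ :=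
  Wseq T N f X Q 1 (Function.update (fun _ => false : ℕ → Bool) 0
      (if 0 ≤ DeltaSeq T N f X Q 0 (fun _ => false) then true else false))
    + (if 0 ≤ DeltaSeq T N f X Q 0 (fun _ => false) then Q 0 else 0)
    - (if 0 ≤ DeltaSeq T N f X Q 0 (fun _ => false) then
        DeltaSeq T N f X Q 0 (fun _ => false) / 2 else 0)

/-- Updating entry `k` does not affect a sum over the entries below `k`. -/
theorem sum_range_ite_update (Q : ℕ → ℝ) (k : ℕ) (b : ℕ → Bool) (c : Bool) :
    (∑ n ∈ range k, if Function.update b k c n then Q n else 0) =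
      ∑ n ∈ range k, if b n then Q n else 0 :=
  sum_congr rfl fun n hn => by rw [Function.update_of_ne (mem_range.mp hn).ne]

/-- The marginal surplus `Δ*_k(b)` is the difference of the two branches compared in the
maximum of the backward recursion. -/
theorem DeltaSeq_eq_Wseq_sub (T N : ℕ) (f : ℕ → ℝ → ℝ) (X : ℕ → ℕ → ℝ) (Q : ℕ → ℝ)
    (k : ℕ) (b : ℕ → Bool) :
    DeltaSeq T N f X Q k b =
      Wseq T N f X Q (k + 1) (Function.update b k true) + Q k -
        Wseq T N f X Q (k + 1) (Function.update b k false) := by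
  simp only [DeltaSeq, Wseq, sum_range_succ, sum_range_ite_update, Function.update_self]
  simp only [if_true, Bool.false_eq_true, if_false]
  ring

/-- One bargaining step expresses `W_k` through `W_{k+1}` at the bargained extension. -/
theorem Wseq_eq_bargaining_step (T N : ℕ) (f : ℕ → ℝ → ℝ) (X : ℕ → ℕ → ℝ) (Q : ℕ → ℝ)
    {k : ℕ} (hk : k < N) (b : ℕ → Bool) :
    Wseq T N f X Q k b =
      Wseq T N f X Q (k + 1) (Function.update b k
          (if 0 ≤ DeltaSeq T N f X Q k b then true else false))
        + (if 0 ≤ DeltaSeq T N f X Q k b then Q k else 0)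
        - (if 0 ≤ DeltaSeq T N f X Q k b then DeltaSeq T N f X Q k b / 2 else 0) := by
  obtain ⟨j, rfl⟩ : ∃ j, N = k + 1 + j := Nat.exists_eq_add_of_lt hk |>.imp fun j hj => by omega
  have hj : k + 1 + j - k = j + 1 := by omega
  have hj' : k + 1 + j - (k + 1) = j := by omega
  have hk' : k + 1 + j - (j + 1) = k := by omega
  simp only [Wseq, sum_range_succ, sum_range_ite_update, Function.update_self, hj, BP, hk']
  simp only [DeltaSeq, hj']
  split_ifs <;> simp_all <;> ring

/-- The bargained value averages the rejection value and the better of the two branches. -/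
theorem bargaining_step_eq_half_add_half_max (T N : ℕ) (f : ℕ → ℝ → ℝ) (X : ℕ → ℕ → ℝ)
    (Q : ℕ → ℝ) (k : ℕ) (b : ℕ → Bool) :
    Wseq T N f X Q (k + 1) (Function.update b k
          (if 0 ≤ DeltaSeq T N f X Q k b then true else false))
        + (if 0 ≤ DeltaSeq T N f X Q k b then Q k else 0)
        - (if 0 ≤ DeltaSeq T N f X Q k b then DeltaSeq T N f X Q k b / 2 else 0) =
      (1 / 2) * Wseq T N f X Q (k + 1) (Function.update b k false) +
        (1 / 2) * max (Wseq T N f X Q (k + 1) (Function.update b k false))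
          (Wseq T N f X Q (k + 1) (Function.update b k true) + Q k) := by
  have h := DeltaSeq_eq_Wseq_sub T N f X Q k b
  by_cases hd : 0 ≤ DeltaSeq T N f X Q k b
  · rw [max_eq_right (by linarith)]
    simp only [hd, if_true]
    linarith
  · rw [max_eq_left (by linarith)]
    simp only [hd, if_false]
    ring

/-- Lemma 1: the Nash-bargaining value functions satisfy the
backward recursion `W_k(b) = ½·W_{k+1}(b,0) + ½·max{W_{k+1}(b,0), W_{k+1}(b,1) + Q_{k+1}}`
for every `k ∈ {1,…,N−1}` (0-based: `1 ≤ k < N`, with `Q` at 0-based index `k`),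
and `W_0 = ½·W_1(0) + ½·max{W_1(0), W_1(1) + Q_1}`. -/
theorem W_backward_recursion (T N : ℕ) (hT : 1 ≤ T) (hN : 1 ≤ N)
    (f : ℕ → ℝ → ℝ) (X : ℕ → ℕ → ℝ) (Q : ℕ → ℝ)
    (hf : ∀ t, t < T → MonotoneOn (f t) (Set.Ici (0 : ℝ)) ∧
      ConcaveOn ℝ (Set.Ici (0 : ℝ)) (f t) ∧ f t 0 = 0)
    (hX : ∀ n, n < N → ∀ t, t < T → 0 ≤ X n t) :
    (∀ k, 1 ≤ k → k < N → ∀ b : ℕ → Bool,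
      Wseq T N f X Q k b =
        (1 / 2) * Wseq T N f X Q (k + 1) (Function.update b k false) +
          (1 / 2) * max (Wseq T N f X Q (k + 1) (Function.update b k false))
            (Wseq T N f X Q (k + 1) (Function.update b k true) + Q k)) ∧
    W0seq T N f X Q =
      (1 / 2) * Wseq T N f X Q 1 (Function.update (fun _ => false : ℕ → Bool) 0 false) +
        (1 / 2) * max (Wseq T N f X Q 1 (Function.update (fun _ => false : ℕ → Bool) 0 false))
          (Wseq T N f X Q 1 (Function.update (fun _ => false : ℕ → Bool) 0 true) + Q 0) := by
  exact ⟨fun k _ hk b => (Wseq_eq_bargaining_step T N f X Q hk b).trans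
      (bargaining_step_eq_half_add_half_max T N f X Q k b),
    bargaining_step_eq_half_add_half_max T N f X Q 0 fun _ => false⟩
end

section
/- For every k ∈ {1,…,N} and all b¹, b² ∈ {0,1}^k, if Σ_{n=1}^k b¹_n X_n^t = Σ_{n=1}^k b²_n X_n^t for every t ∈ {1,…,T}, then W_k(b¹) = W_k(b²). -/
open Finset

/-- Total offloading benefit `Σ_{t<T} f_t(Σ_{n<N} b_n X_n^t)` (0-based indices). -/
noncomputable def socialOffload (T N : ℕ) (f : ℕ → ℝ → ℝ) (X : ℕ → ℕ → ℝ)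
    (b : ℕ → Bool) : ℝ :=
  ∑ t ∈ range T, f t (∑ n ∈ range N, if b n then X n t else 0)

/-- `Waux T N f X Q j b = W_{N-j}(b)`: backward recursion on the number `j` of
remaining bargaining steps.  At step `k = N - (j+1)` (0-based) the recursion is
`W_k(b) = ½·W_{k+1}(b,0) + ½·max{W_{k+1}(b,0), W_{k+1}(b,1) + Q_k}`. -/
noncomputable def Waux (T N : ℕ) (f : ℕ → ℝ → ℝ) (X : ℕ → ℕ → ℝ) (Q : ℕ → ℝ) :
    ℕ → (ℕ → Bool) → ℝ
  | 0, b => socialOffload T N f X b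
  | j + 1, b =>
      (1 / 2) * Waux T N f X Q j (Function.update b (N - (j + 1)) false)
        + (1 / 2) *
          max (Waux T N f X Q j (Function.update b (N - (j + 1)) false))
            (Waux T N f X Q j (Function.update b (N - (j + 1)) true) + Q (N - (j + 1)))

/-- The value function `W_k(b)` of the sequential one-to-many Nash bargaining
(0-based: VO `n` has parameters `Q n`, `X n ·`; `b` is the prefix of outcomes,
only its entries `0,…,k-1` matter). -/
noncomputable def W (T N : ℕ) (f : ℕ → ℝ → ℝ) (X : ℕ → ℕ → ℝ) (Q : ℕ → ℝ)
    (k : ℕ) (b : ℕ → Bool) : ℝ :=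
  Waux T N f X Q (N - k) b

/-- Setting the same outcome at position `k` preserves equality of the offloaded traffic. -/
theorem sum_range_succ_update_eq {k : ℕ} {x : ℕ → ℝ} {b₁ b₂ : ℕ → Bool}
    (h : (∑ n ∈ range k, if b₁ n then x n else 0) = ∑ n ∈ range k, if b₂ n then x n else 0)
    (c : Bool) :
    (∑ n ∈ range (k + 1), if Function.update b₁ k c n then x n else 0) =
      ∑ n ∈ range (k + 1), if Function.update b₂ k c n then x n else 0 := by
  have sum_update (b : ℕ → Bool) :
      (∑ n ∈ range k, if Function.update b k c n then x n else 0) =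
        ∑ n ∈ range k, if b n then x n else 0 :=
    sum_congr rfl fun n hn => by
      rw [Function.update_of_ne (mem_range.mp hn).ne]
  simp only [sum_range_succ, sum_update, Function.update_self, h]

/-- With `j` bargaining steps remaining, the value depends on the earlier outcomes only through
the traffic they offload in each period. -/
theorem Waux_eq_of_sum_eq {T N : ℕ} (f : ℕ → ℝ → ℝ) (X : ℕ → ℕ → ℝ) (Q : ℕ → ℝ)
    {j : ℕ} (hj : j ≤ N) {b₁ b₂ : ℕ → Bool}
    (h : ∀ t, t < T →
      (∑ n ∈ range (N - j), if b₁ n then X n t else 0) =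
        ∑ n ∈ range (N - j), if b₂ n then X n t else 0) :
    Waux T N f X Q j b₁ = Waux T N f X Q j b₂ := by
  induction j generalizing b₁ b₂ with
  | zero => exact sum_congr rfl fun t ht => congrArg (f t) (h t (mem_range.mp ht))
  | succ j ih =>
    have update_eq (c : Bool) :
        Waux T N f X Q j (Function.update b₁ (N - (j + 1)) c) =
          Waux T N f X Q j (Function.update b₂ (N - (j + 1)) c) := by
      refine ih (by lia) fun t ht => ?_
      rw [show N - j = N - (j + 1) + 1 by lia]
      exact sum_range_succ_update_eq (h t ht) c
    simp only [Waux, update_eq]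

/-- Lemma 2: if two outcome prefixes of length `k` offload the same
traffic in every period, the value functions coincide. -/
theorem W_eq_of_sum_eq (T N : ℕ) (hT : 1 ≤ T) (hN : 1 ≤ N)
    (f : ℕ → ℝ → ℝ) (X : ℕ → ℕ → ℝ) (Q : ℕ → ℝ)
    (hf : ∀ t, t < T → MonotoneOn (f t) (Set.Ici (0 : ℝ)) ∧
      ConcaveOn ℝ (Set.Ici (0 : ℝ)) (f t) ∧ f t 0 = 0)
    (hX : ∀ n, n < N → ∀ t, t < T → 0 ≤ X n t) :
    ∀ k, 1 ≤ k → k ≤ N → ∀ b₁ b₂ : ℕ → Bool,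
      (∀ t, t < T →
        (∑ n ∈ range k, if b₁ n then X n t else 0) =
          (∑ n ∈ range k, if b₂ n then X n t else 0)) →
      W T N f X Q k b₁ = W T N f X Q k b₂ := by
  intro k _ hk b₁ b₂ h
  refine Waux_eq_of_sum_eq f X Q (Nat.sub_le N k) ?_
  rwa [Nat.sub_sub_self hk]
end

section
/- For every k ∈ {1,…,N} and all b¹, b² ∈ {0,1}^k, if Σ_{n=1}^k b¹_n X_n^t ≥ Σ_{n=1}^k b²_n X_n^t for every t ∈ {1,…,T}, then W_k(b¹) ≥ W_k(b²). -/
open Finset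

theorem sum_range_succ_update_ite {M : Type*} [AddCommMonoid M] (b : ℕ → Bool) (x : ℕ → M)
    (k : ℕ) (v : Bool) :
    (∑ n ∈ range (k + 1), if Function.update b k v n then x n else 0) =
      (∑ n ∈ range k, if b n then x n else 0) + if v then x k else 0 := by
  rw [sum_range_succ, Function.update_self]
  congr 1
  refine sum_congr rfl fun n hn => ?_
  rw [Function.update_of_ne (mem_range.mp hn).ne]

theorem socialOffload_mono {T N : ℕ} {f : ℕ → ℝ → ℝ} {X : ℕ → ℕ → ℝ}
    (hf : ∀ t, t < T → MonotoneOn (f t) (Set.Ici (0 : ℝ)))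
    (hX : ∀ n, n < N → ∀ t, t < T → 0 ≤ X n t) {b₁ b₂ : ℕ → Bool}
    (h : ∀ t, t < T → (∑ n ∈ range N, if b₂ n then X n t else 0) ≤
      ∑ n ∈ range N, if b₁ n then X n t else 0) :
    socialOffload T N f X b₂ ≤ socialOffload T N f X b₁ := by
  refine sum_le_sum fun t ht => ?_
  have ht := mem_range.mp ht
  have nonneg (b : ℕ → Bool) : 0 ≤ ∑ n ∈ range N, if b n then X n t else 0 :=
    sum_nonneg fun n hn => ite_nonneg (hX n (mem_range.mp hn) t ht) le_rfl
  exact hf t ht (nonneg b₂) (nonneg b₁) (h t ht)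

theorem Waux_mono {T N : ℕ} {f : ℕ → ℝ → ℝ} {X : ℕ → ℕ → ℝ} (Q : ℕ → ℝ)
    (hf : ∀ t, t < T → MonotoneOn (f t) (Set.Ici (0 : ℝ)))
    (hX : ∀ n, n < N → ∀ t, t < T → 0 ≤ X n t) {j : ℕ} (hj : j ≤ N) {b₁ b₂ : ℕ → Bool}
    (h : ∀ t, t < T → (∑ n ∈ range (N - j), if b₂ n then X n t else 0) ≤
      ∑ n ∈ range (N - j), if b₁ n then X n t else 0) :
    Waux T N f X Q j b₂ ≤ Waux T N f X Q j b₁ := by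
  induction j generalizing b₁ b₂ with
  | zero => exact socialOffload_mono hf hX h
  | succ j ih =>
    have step (v : Bool) : Waux T N f X Q j (Function.update b₂ (N - (j + 1)) v) ≤
        Waux T N f X Q j (Function.update b₁ (N - (j + 1)) v) := by
      refine ih (by omega) fun t ht => ?_
      rw [show N - j = N - (j + 1) + 1 by omega,
        sum_range_succ_update_ite b₂ (X · t), sum_range_succ_update_ite b₁ (X · t)]
      exact add_le_add_left (h t ht) _
    simp only [Waux]
    gcongr <;> exact step _

/-- Lemma 3: if a length-`k` outcome prefix offloads at least as much
traffic in every period as another, its value function is at least as large. -/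
theorem W_le_of_sum_le (T N : ℕ) (hT : 1 ≤ T) (hN : 1 ≤ N)
    (f : ℕ → ℝ → ℝ) (X : ℕ → ℕ → ℝ) (Q : ℕ → ℝ)
    (hf : ∀ t, t < T → MonotoneOn (f t) (Set.Ici (0 : ℝ)) ∧
      ConcaveOn ℝ (Set.Ici (0 : ℝ)) (f t) ∧ f t 0 = 0)
    (hX : ∀ n, n < N → ∀ t, t < T → 0 ≤ X n t) :
    ∀ k, 1 ≤ k → k ≤ N → ∀ b₁ b₂ : ℕ → Bool,
      (∀ t, t < T →
        (∑ n ∈ range k, if b₂ n then X n t else 0) ≤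
          (∑ n ∈ range k, if b₁ n then X n t else 0)) →
      W T N f X Q k b₂ ≤ W T N f X Q k b₁ := by
  intro k _ hk b₁ b₂ h
  refine Waux_mono Q (fun t ht => (hf t ht).1) hX (Nat.sub_le N k) ?_
  rwa [Nat.sub_sub_self hk]
end

section
/- If Σ_{t=1}^T f_t(X_{k+2}^t) + Q_{k+2} < 0 (the VO at position k+2 is of type 3), then W̃_k(b) = W_k(b) for every b ∈ {0,1}^k: interchanging the positions k+1 and k+2 leaves the step-k value function unchanged. -/
open Finset

/-- Parameters obtained by interchanging the VOs at (0-based) positions `k` and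
`k+1` (paper positions `k+1` and `k+2`). -/
def swapQ (Q : ℕ → ℝ) (k : ℕ) : ℕ → ℝ :=
  fun n => if n = k then Q (k + 1) else if n = k + 1 then Q k else Q n

def swapX (X : ℕ → ℕ → ℝ) (k : ℕ) : ℕ → ℕ → ℝ :=
  fun n t => if n = k then X (k + 1) t else if n = k + 1 then X k t else X n t

/-- A concave function on `[0,∞)` vanishing at `0` is subadditive. -/
lemma ConcaveOn.map_add_le_of_map_zero {g : ℝ → ℝ} (hg : ConcaveOn ℝ (Set.Ici (0 : ℝ)) g)
    (h0 : g 0 = 0) {x y : ℝ} (hx : 0 ≤ x) (hy : 0 ≤ y) : g (x + y) ≤ g x + g y := by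
  rcases (add_nonneg hx hy).eq_or_lt with h | h
  · obtain rfl : x = 0 := by linarith
    obtain rfl : y = 0 := by linarith
    simp [h0]
  · have key : ∀ z w : ℝ, 0 ≤ z → 0 ≤ w → 0 < z + w →
        z / (z + w) * g (z + w) ≤ g z := by
      intro z w hz hw hzw
      have := hg.2 (Set.mem_Ici.2 hzw.le) (Set.mem_Ici.2 le_rfl)
        (div_nonneg hz hzw.le) (div_nonneg hw hzw.le) (by field_simp)
      simp only [smul_eq_mul, h0, mul_zero, add_zero] at this
      rwa [div_mul_cancel₀ z hzw.ne'] at this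
    have h1 := key x y hx hy h
    have h2 := key y x hy hx (by linarith)
    rw [add_comm y x] at h2
    have h3 : x / (x + y) * g (x + y) + y / (x + y) * g (x + y) = g (x + y) := by
      field_simp
    linarith

/-- The marginal benefit of VO `m` is at most its stand-alone benefit. -/
lemma socialOffload_update_true_le {T N : ℕ} {f : ℕ → ℝ → ℝ} {X : ℕ → ℕ → ℝ}
    (hf : ∀ t, t < T → ConcaveOn ℝ (Set.Ici (0 : ℝ)) (f t) ∧ f t 0 = 0)
    (hX : ∀ n, n < N → ∀ t, t < T → 0 ≤ X n t) {m : ℕ} (hm : m < N) (b : ℕ → Bool) :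
    socialOffload T N f X (Function.update b m true) ≤
      socialOffload T N f X (Function.update b m false) + ∑ t ∈ range T, f t (X m t) := by
  unfold socialOffload
  rw [← sum_add_distrib]
  refine sum_le_sum fun t ht => ?_
  have ht := mem_range.1 ht
  have hsum : (∑ n ∈ range N, if Function.update b m true n then X n t else 0) =
      (∑ n ∈ range N, if Function.update b m false n then X n t else 0) + X m t := by
    rw [← add_sum_erase _ _ (mem_range.2 hm), ← add_sum_erase (range N)
      (fun n => if Function.update b m false n then X n t else 0) (mem_range.2 hm)]
    have : ∀ c : Bool, (∑ n ∈ (range N).erase m, if Function.update b m c n then X n t else 0) =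
        ∑ n ∈ (range N).erase m, if b n then X n t else 0 := fun c =>
      sum_congr rfl fun n hn => by rw [Function.update_of_ne (ne_of_mem_erase hn)]
    rw [this, this]
    simp [add_comm]
  rw [hsum]
  refine (hf t ht).1.map_add_le_of_map_zero (hf t ht).2 (sum_nonneg fun n hn => ?_) (hX m hm t ht)
  split_ifs
  exacts [hX n (mem_range.1 hn) t ht, le_rfl]

lemma Waux_update_true_le {T N : ℕ} {f : ℕ → ℝ → ℝ} {X : ℕ → ℕ → ℝ} (Q : ℕ → ℝ)
    (hf : ∀ t, t < T → ConcaveOn ℝ (Set.Ici (0 : ℝ)) (f t) ∧ f t 0 = 0)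
    (hX : ∀ n, n < N → ∀ t, t < T → 0 ≤ X n t) {m j : ℕ} (hm : j + m < N) (b : ℕ → Bool) :
    Waux T N f X Q j (Function.update b m true) ≤
      Waux T N f X Q j (Function.update b m false) + ∑ t ∈ range T, f t (X m t) := by
  induction j generalizing b with
  | zero => exact socialOffload_update_true_le hf hX (by omega) b
  | succ j ih =>
    have hne : m ≠ N - (j + 1) := by omega
    simp only [Waux, Function.update_comm hne]
    have h0 := ih (by omega) (Function.update b (N - (j + 1)) false)
    have h1 := ih (by omega) (Function.update b (N - (j + 1)) true)
    have h2 := max_le_max h0 (add_le_add_left h1 (Q (N - (j + 1))))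
    rw [add_right_comm, max_add_add_right] at h2
    linarith

/-- Bargaining with a type-3 VO always breaks down. -/
lemma Waux_succ_of_type3 {T N : ℕ} {f : ℕ → ℝ → ℝ} {X : ℕ → ℕ → ℝ} {Q : ℕ → ℝ}
    (hf : ∀ t, t < T → ConcaveOn ℝ (Set.Ici (0 : ℝ)) (f t) ∧ f t 0 = 0)
    (hX : ∀ n, n < N → ∀ t, t < T → 0 ≤ X n t) {m j : ℕ} (hm : m + (j + 1) = N)
    (hQ : (∑ t ∈ range T, f t (X m t)) + Q m < 0) (b : ℕ → Bool) :
    Waux T N f X Q (j + 1) b = Waux T N f X Q j (Function.update b m false) := by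
  have hN : N - (j + 1) = m := by omega
  have h := Waux_update_true_le Q hf hX (m := m) (j := j) (by omega) b
  rw [Waux, hN, max_eq_left (by linarith)]
  ring

lemma swapX_eq_swap (X : ℕ → ℕ → ℝ) (k n : ℕ) :
    swapX X k n = X (Equiv.swap k (k + 1) n) := by
  funext t
  simp only [swapX, Equiv.swap_apply_def]
  split_ifs <;> rfl

lemma socialOffload_swapX (T : ℕ) {N : ℕ} (f : ℕ → ℝ → ℝ) (X : ℕ → ℕ → ℝ) {k : ℕ}
    (hk : k + 2 ≤ N) (b : ℕ → Bool) :
    socialOffload T N f (swapX X k) b =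
      socialOffload T N f X (b ∘ Equiv.swap k (k + 1)) := by
  unfold socialOffload
  refine sum_congr rfl fun t _ => congrArg (f t) ?_
  refine sum_equiv (Equiv.swap k (k + 1)) (fun n => ?_) fun n _ => ?_
  · simp only [mem_range, Equiv.swap_apply_def]
    split_ifs <;> omega
  · simp [swapX_eq_swap]

lemma Waux_swap (T : ℕ) {N : ℕ} (f : ℕ → ℝ → ℝ) (X : ℕ → ℕ → ℝ) (Q : ℕ → ℝ) {k j : ℕ}
    (hk : k + 2 + j ≤ N) (b : ℕ → Bool) :
    Waux T N f (swapX X k) (swapQ Q k) j b =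
      Waux T N f X Q j (b ∘ Equiv.swap k (k + 1)) := by
  induction j generalizing b with
  | zero => exact socialOffload_swapX T f X hk b
  | succ j ih =>
    have hfix : Equiv.swap k (k + 1) (N - (j + 1)) = N - (j + 1) :=
      Equiv.swap_apply_of_ne_of_ne (by omega) (by omega)
    have hQ : swapQ Q k (N - (j + 1)) = Q (N - (j + 1)) := by
      rw [swapQ, if_neg (by omega), if_neg (by omega)]
    have hu : ∀ c, Function.update b (N - (j + 1)) c ∘ Equiv.swap k (k + 1) =
        Function.update (b ∘ Equiv.swap k (k + 1)) (N - (j + 1)) c := fun c => by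
      rw [Function.update_comp_equiv, Equiv.symm_swap, hfix]
    simp only [Waux, ih (show k + 2 + j ≤ N by omega), hu, hQ]

/-- Lemma in the paper: if the VO at (paper) position `k+2` is of
type 3 (`Σ_t f_t(X_{k+2}^t) + Q_{k+2} < 0`), interchanging positions `k+1` and
`k+2` leaves the step-`k` value function unchanged. -/
theorem swap_type3_W_eq (T N : ℕ) (hT : 1 ≤ T) (hN : 2 ≤ N)
    (f : ℕ → ℝ → ℝ) (X : ℕ → ℕ → ℝ) (Q : ℕ → ℝ)
    (hf : ∀ t, t < T → MonotoneOn (f t) (Set.Ici (0 : ℝ)) ∧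
      ConcaveOn ℝ (Set.Ici (0 : ℝ)) (f t) ∧ f t 0 = 0)
    (hX : ∀ n, n < N → ∀ t, t < T → 0 ≤ X n t)
    (k : ℕ) (hk : k + 2 ≤ N)
    (hQ : (∑ t ∈ range T, f t (X (k + 1) t)) + Q (k + 1) < 0) :
    ∀ b : ℕ → Bool,
      W T N f (swapX X k) (swapQ Q k) k b = W T N f X Q k b := by
  intro b
  obtain ⟨j, rfl⟩ := Nat.exists_eq_add_of_le hk
  have hf' : ∀ t, t < T → ConcaveOn ℝ (Set.Ici (0 : ℝ)) (f t) ∧ f t 0 = 0 :=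
    fun t ht => (hf t ht).2
  have hX' : ∀ n, n < k + 2 + j → ∀ t, t < T → 0 ≤ swapX X k n t := by
    intro n hn t ht
    unfold swapX
    split_ifs
    exacts [hX _ (by omega) t ht, hX _ (by omega) t ht, hX _ hn t ht]
  have hQ' : (∑ t ∈ range T, f t (swapX X k k t)) + swapQ Q k k < 0 := by
    simpa [swapX, swapQ] using hQ
  have hsteps : k + 2 + j - k = j + 1 + 1 := by omega
  have hpos : k + 2 + j - (j + 1 + 1) = k := by omega
  have hpos' : k + 2 + j - (j + 1) = k + 1 := by omega
  have hQk : swapQ Q k (k + 1) = Q k := by simp [swapQ]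
  unfold W
  rw [hsteps, Waux_succ_of_type3 hf' hX' (by omega) hQ', Waux, Waux, hpos, hpos']
  simp only [Waux_succ_of_type3 hf' hX (show k + 1 + (j + 1) = k + 2 + j by omega) hQ,
    Waux_swap T f X Q le_rfl, hQk, Function.update_comp_equiv, Equiv.symm_swap,
    Equiv.swap_apply_left, Equiv.swap_apply_right]
  have hu : ∀ c d, Function.update (Function.update (b ∘ Equiv.swap k (k + 1)) (k + 1) c) k d =
      Function.update (Function.update b k d) (k + 1) c := by
    intro c d
    funext n
    simp only [Function.update_apply, Function.comp_apply]
    split_ifs <;> first | rfl | omega | rw [Equiv.swap_apply_of_ne_of_ne ‹_› ‹_›]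
  simp only [hu]
end

section
/- If Q_{k+2} ≥ Q_{k+1} and X_{k+2}^t ≥ X_{k+1}^t for every t ∈ {1,…,T}, then W̃_k(b) ≥ W_k(b) for every b ∈ {0,1}^k: moving the dominant VO from position k+2 to position k+1 does not decrease the step-k value function. -/
open Finset

/-- `Waux` is monotone in the partial sums of the decided positions and in the transfers `Q` of
the undecided ones. -/
theorem Waux_le_Waux {T N : ℕ} {f : ℕ → ℝ → ℝ} {X X' : ℕ → ℕ → ℝ} {Q Q' : ℕ → ℝ}
    (hf : ∀ t < T, MonotoneOn (f t) (Set.Ici (0 : ℝ)))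
    (hX : ∀ n < N, ∀ t < T, 0 ≤ X n t) (j : ℕ) (hj : j ≤ N)
    (hQQ : ∀ n, N - j ≤ n → Q n ≤ Q' n)
    (hXX : ∀ n, N - j ≤ n → ∀ t < T, X n t ≤ X' n t) (b b' : ℕ → Bool)
    (h : ∀ t < T, (∑ n ∈ range (N - j), if b n then X n t else 0) ≤
      ∑ n ∈ range (N - j), if b' n then X' n t else 0) :
    Waux T N f X Q j b ≤ Waux T N f X' Q' j b' := by
  induction j generalizing b b' with
  | zero =>
    simp only [Waux, socialOffload]
    refine sum_le_sum fun t ht => ?_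
    have ht := mem_range.1 ht
    have h0 : (0 : ℝ) ≤ ∑ n ∈ range N, if b n then X n t else 0 :=
      sum_nonneg fun n hn => by
        split_ifs
        exacts [hX n (mem_range.1 hn) t ht, le_rfl]
    exact hf t ht h0 (h0.trans (h t ht)) (h t ht)
  | succ j ih =>
    have key : ∀ c : Bool, Waux T N f X Q j (Function.update b (N - (j + 1)) c) ≤
        Waux T N f X' Q' j (Function.update b' (N - (j + 1)) c) := by
      intro c
      refine ih (by omega) (fun n hn => hQQ n (by omega)) (fun n hn => hXX n (by omega)) _ _ ?_
      intro t ht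
      have agree : ∀ (Y : ℕ → ℕ → ℝ) (d : ℕ → Bool),
          (∑ n ∈ range (N - (j + 1)),
            if Function.update d (N - (j + 1)) c n then Y n t else 0) =
          ∑ n ∈ range (N - (j + 1)), if d n then Y n t else 0 := fun Y d =>
        sum_congr rfl fun n hn => by
          rw [Function.update_of_ne (mem_range.1 hn).ne]
      rw [show N - j = N - (j + 1) + 1 by omega, sum_range_succ, sum_range_succ, agree, agree,
        Function.update_self, Function.update_self]
      refine add_le_add (h t ht) ?_
      split_ifs
      exacts [hXX _ le_rfl t ht, le_rfl]
    have hq := hQQ _ le_rfl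
    have h0 := key false
    have h1 := key true
    simp only [Waux]
    gcongr

/-- Two-step bargaining with continuation values `A` (no agreement), `B` and `C` (one agreement)
and `D` (two agreements): bargaining first for the better agreement is no worse. -/
theorem two_step_bargaining_le {A B C D q p : ℝ} (h : B + q ≤ C + p) :
    (1 / 2) * ((1 / 2) * A + (1 / 2) * max A (C + p)) +
        (1 / 2) * max ((1 / 2) * A + (1 / 2) * max A (C + p))
          ((1 / 2) * B + (1 / 2) * max B (D + p) + q) ≤
      (1 / 2) * ((1 / 2) * A + (1 / 2) * max A (B + q)) +
        (1 / 2) * max ((1 / 2) * A + (1 / 2) * max A (B + q))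
          ((1 / 2) * C + (1 / 2) * max C (D + q) + p) := by
  grind

theorem sum_range_add_two_update (X : ℕ → ℕ → ℝ) (k t : ℕ) (b : ℕ → Bool) (c d : Bool) :
    (∑ n ∈ range (k + 2),
      if Function.update (Function.update b k c) (k + 1) d n then X n t else 0) =
    (∑ n ∈ range k, if b n then X n t else 0) + (if c then X k t else 0) +
      (if d then X (k + 1) t else 0) := by
  rw [sum_range_succ, sum_range_succ, Function.update_self,
    Function.update_of_ne (by omega : k ≠ k + 1), Function.update_self]
  congr 2
  refine sum_congr rfl fun n hn => ?_
  have := mem_range.1 hn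
  rw [Function.update_of_ne (by omega), Function.update_of_ne (by omega)]

/-- Lemma 7: if the VO at (paper) position `k+2` dominates the one
at position `k+1` (`Q_{k+2} ≥ Q_{k+1}` and `X_{k+2}^t ≥ X_{k+1}^t` for every `t`),
moving it one position earlier does not decrease the step-`k` value function. -/
theorem swap_dominant_W_le (T N : ℕ) (hT : 1 ≤ T) (hN : 2 ≤ N)
    (f : ℕ → ℝ → ℝ) (X : ℕ → ℕ → ℝ) (Q : ℕ → ℝ)
    (hf : ∀ t, t < T → MonotoneOn (f t) (Set.Ici (0 : ℝ)) ∧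
      ConcaveOn ℝ (Set.Ici (0 : ℝ)) (f t) ∧ f t 0 = 0)
    (hX : ∀ n, n < N → ∀ t, t < T → 0 ≤ X n t)
    (k : ℕ) (hk : k + 2 ≤ N)
    (hQ : Q k ≤ Q (k + 1)) (hXd : ∀ t, t < T → X k t ≤ X (k + 1) t) :
    ∀ b : ℕ → Bool,
      W T N f X Q k b ≤ W T N f (swapX X k) (swapQ Q k) k b := by
  intro b
  have hm : ∀ t < T, MonotoneOn (f t) (Set.Ici (0 : ℝ)) := fun t ht => (hf t ht).1
  obtain ⟨i, rfl⟩ : ∃ i, N = k + i + 2 := ⟨N - (k + 2), by omega⟩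
  have e0 : k + i + 2 - i = k + 2 := by omega
  have e1 : k + i + 2 - (i + 1) = k + 1 := by omega
  have e2 : k + i + 2 - (i + 2) = k := by omega
  have swap : ∀ c d : Bool,
      Waux T (k + i + 2) f X Q i (Function.update (Function.update b k c) (k + 1) d) ≤
      Waux T (k + i + 2) f (swapX X k) (swapQ Q k) i
        (Function.update (Function.update b k d) (k + 1) c) := by
    intro c d
    refine Waux_le_Waux hm hX i (by omega) (fun n hn => ?_) (fun n hn t ht => ?_) _ _
      fun t ht => ?_
    · rw [e0] at hn
      simp [swapQ, show n ≠ k by omega, show n ≠ k + 1 by omega]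
    · rw [e0] at hn
      simp [swapX, show n ≠ k by omega, show n ≠ k + 1 by omega]
    · rw [e0, sum_range_add_two_update, sum_range_add_two_update]
      have hs : (∑ n ∈ range k, if b n then swapX X k n t else 0) =
          ∑ n ∈ range k, if b n then X n t else 0 :=
        sum_congr rfl fun n hn => by
          have := mem_range.1 hn
          simp [swapX, show n ≠ k by omega, show n ≠ k + 1 by omega]
      rw [hs]
      simp only [swapX, if_true, if_neg (show k + 1 ≠ k by omega)]
      exact (add_right_comm _ _ _).le
  have hBC : Waux T (k + i + 2) f X Q i
        (Function.update (Function.update b k true) (k + 1) false) ≤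
      Waux T (k + i + 2) f X Q i
        (Function.update (Function.update b k false) (k + 1) true) := by
    refine Waux_le_Waux hm hX i (by omega) (fun _ _ => le_rfl) (fun _ _ _ _ => le_rfl) _ _
      fun t ht => ?_
    rw [e0, sum_range_add_two_update, sum_range_add_two_update]
    simpa using hXd t ht
  have hA := swap false false
  have hB := swap true false
  have hC := swap false true
  have hD := swap true true
  have q0 : swapQ Q k k = Q (k + 1) := by simp [swapQ]
  have q1 : swapQ Q k (k + 1) = Q k := by simp [swapQ]
  rw [W, W, show k + i + 2 - k = i + 2 by omega]
  simp only [Waux, e1, e2, q0, q1]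
  refine (two_step_bargaining_le (add_le_add hBC hQ)).trans ?_
  gcongr
end

section
/- Suppose the VOs are homogeneous: Q_n = Q and X_n^t = X^t for all n ∈ {1,…,N} and t ∈ {1,…,T}. Then for every n ∈ {2,…,N} and every b ∈ {0,1}^{n−2}: W_n(b,0,1) − W_n(b,0,0) ≥ W_n(b,1,1) − W_n(b,1,0). -/
open Finset

/-- Number of agreements among the first `k` outcomes. -/
def agreementCount (b : ℕ → Bool) (k : ℕ) : ℕ :=
  ∑ n ∈ range k, if b n then 1 else 0

/-- The value function of the homogeneous bargaining as a function of the number `m` of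
agreements reached so far, with `j` steps remaining and terminal value `g`. -/
noncomputable def countValue (g : ℕ → ℝ) (q : ℝ) : ℕ → ℕ → ℝ
  | 0, m => g m
  | j + 1, m =>
      (1 / 2) * countValue g q j m
        + (1 / 2) * max (countValue g q j m) (countValue g q j (m + 1) + q)

lemma agreementCount_update_self (b : ℕ → Bool) (k : ℕ) (v : Bool) :
    agreementCount (Function.update b k v) (k + 1)
      = agreementCount b k + if v then 1 else 0 := by
  unfold agreementCount
  rw [sum_range_succ, Function.update_self]
  congr 1
  refine sum_congr rfl fun n hn => ?_
  rw [Function.update_of_ne (mem_range.mp hn).ne]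

/-- One bargaining step preserves discrete concavity. -/
lemma countValue_concave (g : ℕ → ℝ) (q : ℝ)
    (hg : ∀ m, g (m + 2) - g (m + 1) ≤ g (m + 1) - g m) (j m : ℕ) :
    countValue g q j (m + 2) - countValue g q j (m + 1)
      ≤ countValue g q j (m + 1) - countValue g q j m := by
  induction j generalizing m with
  | zero => exact hg m
  | succ j ih =>
    have h₀ := ih m
    have h₁ := ih (m + 1)
    simp only [countValue, add_assoc, Nat.reduceAdd] at h₀ h₁ ⊢
    rcases max_cases (countValue g q j m) (countValue g q j (m + 1) + q) with h | h <;>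
    rcases max_cases (countValue g q j (m + 1)) (countValue g q j (m + 2) + q) with h' | h' <;>
    rcases max_cases (countValue g q j (m + 2)) (countValue g q j (m + 3) + q) with h'' | h'' <;>
    linarith

lemma ConcaveOn.sub_le_sub_natCast_mul {φ : ℝ → ℝ} (hφ : ConcaveOn ℝ (Set.Ici 0) φ)
    {x : ℝ} (hx : 0 ≤ x) (m : ℕ) :
    φ ((m + 2 : ℕ) * x) - φ ((m + 1 : ℕ) * x) ≤ φ ((m + 1 : ℕ) * x) - φ (m * x) := by
  have hmem (k : ℕ) : (k : ℝ) * x ∈ Set.Ici (0 : ℝ) := Set.mem_Ici.mpr (by positivity)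
  have h := hφ.2 (hmem m) (hmem (m + 2)) (show (0 : ℝ) ≤ 1 / 2 by norm_num)
    (show (0 : ℝ) ≤ 1 / 2 by norm_num) (by norm_num)
  have hmid : (1 / 2 : ℝ) • ((m : ℝ) * x) + (1 / 2 : ℝ) • (((m + 2 : ℕ) : ℝ) * x)
      = ((m + 1 : ℕ) : ℝ) * x := by
    simp only [smul_eq_mul]
    push_cast
    ring
  rw [hmid] at h
  simp only [smul_eq_mul] at h
  linarith

lemma Waux_eq_countValue {T N : ℕ} {f : ℕ → ℝ → ℝ} {X : ℕ → ℕ → ℝ} {Q : ℕ → ℝ} {Qc : ℝ}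
    {Xc : ℕ → ℝ} (hQh : ∀ n, n < N → Q n = Qc)
    (hXh : ∀ n, n < N → ∀ t, t < T → X n t = Xc t) {j : ℕ} (hj : j ≤ N) (b : ℕ → Bool) :
    Waux T N f X Q j b
      = countValue (fun m => ∑ t ∈ range T, f t (m * Xc t)) Qc j
          (agreementCount b (N - j)) := by
  induction j generalizing b with
  | zero =>
    simp only [Waux, socialOffload, countValue, agreementCount, Nat.sub_zero]
    refine sum_congr rfl fun t ht => ?_
    congr 1
    rw [Nat.cast_sum, sum_mul]
    refine sum_congr rfl fun n hn => ?_
    rw [hXh n (mem_range.mp hn) t (mem_range.mp ht)]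
    split_ifs <;> simp
  | succ j ih =>
    have hk : N - j = N - (j + 1) + 1 := by omega
    simp only [Waux, countValue, ih (Nat.le_of_succ_le hj), hk, agreementCount_update_self,
      hQh (N - (j + 1)) (by omega)]
    simp

/-- Lemma 8: with homogeneous VOs (`Q_n = Q`, `X_n^t = X^t`), for
every `n ∈ {2,…,N}` (1-based) and prefix `b` of length `n-2`,
`W_n(b,0,1) − W_n(b,0,0) ≥ W_n(b,1,1) − W_n(b,1,0)`
(0-based: the last two coordinates are at indices `n-2` and `n-1`). -/
theorem homogeneous_W_submodular (T N : ℕ) (hT : 1 ≤ T) (hN : 2 ≤ N)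
    (f : ℕ → ℝ → ℝ) (X : ℕ → ℕ → ℝ) (Q : ℕ → ℝ) (Qc : ℝ) (Xc : ℕ → ℝ)
    (hf : ∀ t, t < T → MonotoneOn (f t) (Set.Ici (0 : ℝ)) ∧
      ConcaveOn ℝ (Set.Ici (0 : ℝ)) (f t) ∧ f t 0 = 0)
    (hX : ∀ n, n < N → ∀ t, t < T → 0 ≤ X n t)
    (hQh : ∀ n, n < N → Q n = Qc)
    (hXh : ∀ n, n < N → ∀ t, t < T → X n t = Xc t) :
    ∀ n, 2 ≤ n → n ≤ N → ∀ b : ℕ → Bool,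
      W T N f X Q n (Function.update (Function.update b (n - 2) true) (n - 1) true)
          - W T N f X Q n (Function.update (Function.update b (n - 2) true) (n - 1) false)
        ≤ W T N f X Q n (Function.update (Function.update b (n - 2) false) (n - 1) true)
          - W T N f X Q n (Function.update (Function.update b (n - 2) false) (n - 1) false) := by
  intro n hn hnN b
  obtain ⟨k, rfl⟩ := Nat.exists_eq_add_of_le' hn
  have hk : N - (N - (k + 2)) = k + 1 + 1 := by omega
  simp only [W, Waux_eq_countValue hQh hXh (Nat.sub_le N (k + 2)), hk,
    Nat.add_sub_cancel, show k + 2 - 1 = k + 1 from rfl, agreementCount_update_self]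
  refine countValue_concave _ Qc (fun m => ?_) _ (agreementCount b k)
  simp only [← sum_sub_distrib]
  refine sum_le_sum fun t ht => ?_
  have ht := mem_range.mp ht
  exact (hf t ht).2.1.sub_le_sub_natCast_mul
    (hXh 0 (by omega) t ht ▸ hX 0 (by omega) t ht) m
end

section
/- If Q_k ≥ 0 for some k ∈ {1,…,N} (VO k is of type 1), then Δ_k(b) ≥ 0 for every b ∈ {0,1}^{k−1}; consequently the MNO cooperates with VO k regardless of the outcomes of all prior bargaining steps, and in particular b̂_k = 1. -/
open Finset

/-- `Δ_k(b) = W_{k+1}(b,1) − W_{k+1}(b,0) + Q_k` (0-based step `k`, prefix `b` of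
length `k`; paper's `Δ_{k+1}`). -/
noncomputable def Delta (T N : ℕ) (f : ℕ → ℝ → ℝ) (X : ℕ → ℕ → ℝ) (Q : ℕ → ℝ)
    (k : ℕ) (b : ℕ → Bool) : ℝ :=
  W T N f X Q (k + 1) (Function.update b k true)
    - W T N f X Q (k + 1) (Function.update b k false) + Q k

/-- `bhatFn … k` is the realized outcome prefix after the first `k` bargaining
steps: `b̂_k = 1` iff `Δ_k(b̂_1,…,b̂_{k-1}) ≥ 0`. -/
noncomputable def bhatFn (T N : ℕ) (f : ℕ → ℝ → ℝ) (X : ℕ → ℕ → ℝ) (Q : ℕ → ℝ) :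
    ℕ → (ℕ → Bool)
  | 0 => fun _ => false
  | k + 1 =>
      Function.update (bhatFn T N f X Q k) k
        (if 0 ≤ Delta T N f X Q k (bhatFn T N f X Q k) then true else false)

/-- The realized payoff `π̂_k` of the VO bargaining at (0-based) step `k`. -/
noncomputable def pihat (T N : ℕ) (f : ℕ → ℝ → ℝ) (X : ℕ → ℕ → ℝ) (Q : ℕ → ℝ)
    (k : ℕ) : ℝ :=
  if 0 ≤ Delta T N f X Q k (bhatFn T N f X Q k)
  then Delta T N f X Q k (bhatFn T N f X Q k) / 2 else 0

theorem monotone_socialOffload {T N : ℕ} {f : ℕ → ℝ → ℝ} {X : ℕ → ℕ → ℝ}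
    (hf : ∀ t, t < T → MonotoneOn (f t) (Set.Ici (0 : ℝ)))
    (hX : ∀ n, n < N → ∀ t, t < T → 0 ≤ X n t) :
    Monotone (socialOffload T N f X) := by
  intro b c hbc
  refine sum_le_sum fun t ht => ?_
  rw [mem_range] at ht
  have hnonneg : ∀ d : ℕ → Bool, 0 ≤ ∑ n ∈ range N, if d n then X n t else 0 := fun d =>
    sum_nonneg fun n hn => by
      split_ifs
      exacts [hX n (mem_range.mp hn) t ht, le_rfl]
  refine hf t ht (hnonneg b) (hnonneg c) (sum_le_sum fun n hn => ?_)
  have hle : b n = true → c n = true := hbc n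
  have hXn := hX n (mem_range.mp hn) t ht
  split_ifs with hb hc hc
  exacts [le_rfl, absurd (hle hb) hc, hXn, le_rfl]

theorem monotone_Waux {T N : ℕ} {f : ℕ → ℝ → ℝ} {X : ℕ → ℕ → ℝ}
    (hf : ∀ t, t < T → MonotoneOn (f t) (Set.Ici (0 : ℝ)))
    (hX : ∀ n, n < N → ∀ t, t < T → 0 ≤ X n t) (Q : ℕ → ℝ) (j : ℕ) :
    Monotone (Waux T N f X Q j) := by
  induction j with
  | zero => exact monotone_socialOffload hf hX
  | succ j ih =>
    intro b c hbc
    have hupdate : ∀ a, Waux T N f X Q j (Function.update b (N - (j + 1)) a) ≤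
        Waux T N f X Q j (Function.update c (N - (j + 1)) a) := fun a =>
      ih (update_le_update_iff.mpr ⟨le_rfl, fun i _ => hbc i⟩)
    have hfalse := hupdate false
    have htrue := hupdate true
    simp only [Waux]
    gcongr

theorem Delta_nonneg {T N : ℕ} {f : ℕ → ℝ → ℝ} {X : ℕ → ℕ → ℝ}
    (hf : ∀ t, t < T → MonotoneOn (f t) (Set.Ici (0 : ℝ)))
    (hX : ∀ n, n < N → ∀ t, t < T → 0 ≤ X n t) {Q : ℕ → ℝ} {k : ℕ} (hQ : 0 ≤ Q k)
    (b : ℕ → Bool) : 0 ≤ Delta T N f X Q k b := by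
  have hW : W T N f X Q (k + 1) (Function.update b k false) ≤
      W T N f X Q (k + 1) (Function.update b k true) :=
    monotone_Waux hf hX Q _ (update_le_update_iff.mpr ⟨Bool.false_le _, fun _ _ => le_rfl⟩)
  unfold Delta
  linarith

/-- An outcome is never revised by later bargaining steps. -/
theorem bhatFn_apply_of_lt (T N : ℕ) (f : ℕ → ℝ → ℝ) (X : ℕ → ℕ → ℝ) (Q : ℕ → ℝ)
    {k m : ℕ} (hkm : k < m) :
    bhatFn T N f X Q m k = bhatFn T N f X Q (k + 1) k := by
  induction m, hkm using Nat.le_induction with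
  | base => rfl
  | succ m hm ih =>
    rw [bhatFn, Function.update_of_ne (by omega), ih]

/-- Proposition 2: if VO `k` is of type 1 (`Q_k ≥ 0`), then
`Δ_k(b) ≥ 0` for every prior-outcome prefix `b`; consequently the MNO cooperates
with VO `k` regardless of the prior outcomes, and in particular `b̂_k = 1`. -/
theorem type1_always_cooperate (T N : ℕ) (hT : 1 ≤ T) (hN : 1 ≤ N)
    (f : ℕ → ℝ → ℝ) (X : ℕ → ℕ → ℝ) (Q : ℕ → ℝ)
    (hf : ∀ t, t < T → MonotoneOn (f t) (Set.Ici (0 : ℝ)) ∧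
      ConcaveOn ℝ (Set.Ici (0 : ℝ)) (f t) ∧ f t 0 = 0)
    (hX : ∀ n, n < N → ∀ t, t < T → 0 ≤ X n t)
    (k : ℕ) (hk : k < N) (hQ : 0 ≤ Q k) :
    (∀ b : ℕ → Bool, 0 ≤ Delta T N f X Q k b) ∧
      bhatFn T N f X Q N k = true := by
  have hDelta := Delta_nonneg (fun t ht => (hf t ht).1) hX hQ
  refine ⟨hDelta, ?_⟩
  rw [bhatFn_apply_of_lt T N f X Q hk, bhatFn, Function.update_self, if_pos (hDelta _)]
end

section
/- There exists a permutation σ* of {1,…,N} such that U_0^{σ*} ≥ U_0^σ for every permutation σ, the VOs σ*(1),…,σ*(N_1) are all of type 1, and the VOs σ*(N_1+N_2+1),…,σ*(N) are all of type 3 (so the middle N_2 positions hold exactly the type-2 VOs). In other words, there is an optimal bargaining sequence in which the MNO bargains with all type-1 VOs first, then the type-2 VOs, then the type-3 VOs. -/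
open Finset

/-- Parameters reindexed by a bargaining sequence `σ`: at (0-based) step `k < N`
the MNO bargains with VO `σ k`. -/
noncomputable def permQ (N : ℕ) (Q : ℕ → ℝ) (σ : Equiv.Perm (Fin N)) : ℕ → ℝ :=
  fun k => if h : k < N then Q ((σ ⟨k, h⟩ : Fin N) : ℕ) else Q k

noncomputable def permX (N : ℕ) (X : ℕ → ℕ → ℝ) (σ : Equiv.Perm (Fin N)) :
    ℕ → ℕ → ℝ :=
  fun n t => if h : n < N then X ((σ ⟨n, h⟩ : Fin N) : ℕ) t else X n t

/-- `U_0^σ = W_0^σ`: the MNO's payoff under the bargaining sequence `σ`. -/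
noncomputable def U0perm (T N : ℕ) (f : ℕ → ℝ → ℝ) (X : ℕ → ℕ → ℝ) (Q : ℕ → ℝ)
    (σ : Equiv.Perm (Fin N)) : ℝ :=
  W T N f (permX N X σ) (permQ N Q σ) 0 (fun _ => false)

/-- `N₁`: the number of type-1 VOs (those with `Q_n ≥ 0`). -/
noncomputable def numType1 (N : ℕ) (Q : ℕ → ℝ) : ℕ :=
  ((range N).filter fun n => 0 ≤ Q n).card

/-- `N₂`: the number of type-2 VOs (`Q_n < 0` and `Σ_t f_t(X_n^t) + Q_n ≥ 0`). -/
noncomputable def numType2 (T N : ℕ) (f : ℕ → ℝ → ℝ) (X : ℕ → ℕ → ℝ)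
    (Q : ℕ → ℝ) : ℕ :=
  ((range N).filter fun n =>
    Q n < 0 ∧ 0 ≤ (∑ t ∈ range T, f t (X n t)) + Q n).card

/-- `N₃`: the number of type-3 VOs (`Σ_t f_t(X_n^t) + Q_n < 0`). -/
noncomputable def numType3 (T N : ℕ) (f : ℕ → ℝ → ℝ) (X : ℕ → ℕ → ℝ)
    (Q : ℕ → ℝ) : ℕ :=
  ((range N).filter fun n => (∑ t ∈ range T, f t (X n t)) + Q n < 0).card

/-- A concave function on `[0, ∞)` vanishing at `0` is subadditive there. -/
theorem ConcaveOn.map_add_le_of_map_zero_s12 {g : ℝ → ℝ} (hg : ConcaveOn ℝ (Set.Ici 0) g)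
    (h0 : g 0 = 0) {a b : ℝ} (ha : 0 ≤ a) (hb : 0 ≤ b) : g (a + b) ≤ g a + g b := by
  rcases (add_nonneg ha hb).eq_or_lt with h | h
  · obtain rfl : a = 0 := by linarith
    obtain rfl : b = 0 := by linarith
    simp [h0]
  · have key : ∀ c d : ℝ, 0 ≤ c → 0 ≤ d → c + d = a + b →
        c / (a + b) * g (a + b) ≤ g c := by
      intro c d hc hd hcd
      have := hg.2 (Set.mem_Ici.2 h.le) (Set.mem_Ici.2 le_rfl)
        (div_nonneg hc h.le) (div_nonneg hd h.le)
        (by rw [← add_div, hcd, div_self h.ne'])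
      simpa [h0, div_mul_cancel₀ _ h.ne'] using this
    have h1 := key a b ha hb rfl
    have h2 := key b a hb ha (add_comm b a)
    have h3 : a / (a + b) * g (a + b) + b / (a + b) * g (a + b) = g (a + b) := by
      rw [← add_mul, ← add_div, div_self h.ne', one_mul]
    linarith

section Bargaining

variable {S ι : Type*} [AddCommMonoid S]

/-- One bargaining step with a VO of parameters `q`, `y`, acting on value functions of the
aggregate offloading state. -/
noncomputable def bargain (q : ℝ) (y : S) (V : S → ℝ) (x : S) : ℝ :=
  (1 / 2) * V x + (1 / 2) * max (V x) (V (x + y) + q)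

/-- The value function `V` is increasing along addition, with increments bounded by `G`. -/
def IncrementsBounded (G V : S → ℝ) : Prop :=
  ∀ x y, V x ≤ V (x + y) ∧ V (x + y) ≤ V x + G y

theorem bargain_mono (q : ℝ) (y : S) : Monotone (bargain q y) := by
  intro V V' h x
  have h1 := h x
  have h2 := max_le_max (h x) (add_le_add_left (h (x + y)) q)
  simp only [bargain]
  linarith

theorem IncrementsBounded.bargain {G V : S → ℝ} (hV : IncrementsBounded G V) (q : ℝ) (z : S) :
    IncrementsBounded G (bargain q z V) := by
  intro x y
  have h1 := hV x y
  have h2 := hV (x + z) y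
  rw [add_right_comm] at h2
  have h3 : max (V x) (V (x + z) + q) ≤ max (V (x + y)) (V (x + y + z) + q) :=
    max_le_max h1.1 (by linarith)
  have h4 : max (V (x + y)) (V (x + y + z) + q) ≤ max (V x) (V (x + z) + q) + G y := by
    rw [max_add]
    exact max_le_max h1.2 (by linarith)
  simp only [_root_.bargain]
  constructor <;> linarith

/-- Bargaining with a type-3 VO never changes the value function. -/
theorem IncrementsBounded.bargain_eq_self {G V : S → ℝ} (hV : IncrementsBounded G V) {q : ℝ}
    {y : S} (h : G y + q < 0) : _root_.bargain q y V = V := by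
  funext x
  have := (hV x y).2
  rw [_root_.bargain, max_eq_left (by linarith)]
  ring

/-- Bargaining with a type-1 VO before any given VO is at least as good as after it. -/
theorem IncrementsBounded.bargain_comm_le {G V : S → ℝ} (hV : IncrementsBounded G V) {q r : ℝ}
    (hq : 0 ≤ q) (y z : S) :
    _root_.bargain r z (_root_.bargain q y V) ≤ _root_.bargain q y (_root_.bargain r z V) := by
  have accept : ∀ {V' : S → ℝ}, IncrementsBounded G V' → ∀ x,
      _root_.bargain q y V' x = (1 / 2) * V' x + (1 / 2) * (V' (x + y) + q) := by
    intro V' hV' x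
    have := (hV' x y).1
    rw [_root_.bargain, max_eq_right (by linarith)]
  intro x
  rw [accept (hV.bargain r z)]
  simp only [_root_.bargain.eq_1 r z, accept hV, add_right_comm x y z]
  have h1 := le_max_left (V x) (V (x + z) + r)
  have h2 := le_max_right (V x) (V (x + z) + r)
  have h3 := le_max_left (V (x + y)) (V (x + z + y) + r)
  have h4 := le_max_right (V (x + y)) (V (x + z + y) + r)
  have h5 : max (1 / 2 * V x + 1 / 2 * (V (x + y) + q))
      (1 / 2 * V (x + z) + 1 / 2 * (V (x + z + y) + q) + r) ≤
      (1 / 2) * max (V x) (V (x + z) + r) +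
        (1 / 2) * (max (V (x + y)) (V (x + z + y) + r) + q) :=
    max_le (by linarith) (by linarith)
  linarith

/-- The value function when the VOs of the list `l` remain, with terminal value `G`. -/
noncomputable def sequenceValue (q : ι → ℝ) (y : ι → S) (G : S → ℝ) (l : List ι) : S → ℝ :=
  l.foldr (fun i => bargain (q i) (y i)) G

theorem IncrementsBounded.sequenceValue {G : S → ℝ} (hG : IncrementsBounded G G) (q : ι → ℝ)
    (y : ι → S) (l : List ι) : IncrementsBounded G (sequenceValue q y G l) := by
  induction l with
  | nil => exact hG
  | cons i l ih => exact ih.bargain _ _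

/-- The type of a VO, as a number in `{0, 1, 2}`. -/
noncomputable def voType (q : ι → ℝ) (y : ι → S) (G : S → ℝ) (i : ι) : ℕ :=
  if 0 ≤ q i then 0 else if 0 ≤ G (y i) + q i then 1 else 2

theorem sequenceValue_cons_le_orderedInsert {G : S → ℝ} (hG : IncrementsBounded G G)
    (q : ι → ℝ) (y : ι → S) (a : ι) (l : List ι) :
    sequenceValue q y G (a :: l) ≤ sequenceValue q y G
      (l.orderedInsert (fun i j => voType q y G i ≤ voType q y G j) a) := by
  induction l with
  | nil => exact le_rfl
  | cons b l ih =>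
    rw [List.orderedInsert_cons]
    split_ifs with hab
    · exact le_rfl
    · have hl := hG.sequenceValue q y l
      refine le_trans ?_ (bargain_mono (q b) (y b) ih)
      change bargain (q a) (y a) (bargain (q b) (y b) (sequenceValue q y G l)) ≤
        bargain (q b) (y b) (bargain (q a) (y a) (sequenceValue q y G l))
      by_cases hb : 0 ≤ q b
      · exact hl.bargain_comm_le hb _ _
      · have ha : G (y a) + q a < 0 := by
          by_contra hcon
          refine hab ?_
          simp only [voType]
          split_ifs <;> first | omega | linarith
        rw [(hl.bargain _ _).bargain_eq_self ha, hl.bargain_eq_self ha]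

theorem sequenceValue_le_insertionSort {G : S → ℝ} (hG : IncrementsBounded G G)
    (q : ι → ℝ) (y : ι → S) (l : List ι) :
    sequenceValue q y G l ≤ sequenceValue q y G
      (l.insertionSort (fun i j => voType q y G i ≤ voType q y G j)) := by
  induction l with
  | nil => exact le_rfl
  | cons a l ih =>
    exact (bargain_mono (q a) (y a) ih).trans (sequenceValue_cons_le_orderedInsert hG q y a _)

end Bargaining

/-- Insertion sort by `key` of the values of a permutation lists the values of another
permutation, along which `key` is monotone. -/
theorem exists_perm_ofFn_eq_insertionSort {N : ℕ} (key : Fin N → ℕ) (τ : Equiv.Perm (Fin N)) :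
    ∃ σ : Equiv.Perm (Fin N), Monotone (key ∘ σ) ∧
      List.ofFn σ = (List.ofFn τ).insertionSort (fun i j => key i ≤ key j) := by
  set r : Fin N → Fin N → Prop := fun i j => key i ≤ key j
  have : Std.Total r := ⟨fun i j => le_total (key i) (key j)⟩
  have : IsTrans (Fin N) r := ⟨fun i j k => le_trans (a := key i)⟩
  set L := (List.ofFn τ).insertionSort r with hL
  have hperm : L.Perm (List.ofFn τ) := List.perm_insertionSort _ _
  have hlen : L.length = N := by rw [hperm.length_eq, List.length_ofFn]
  have hnodup : L.Nodup := hperm.nodup_iff.2 (List.nodup_ofFn.2 τ.injective)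
  have hsort : L.Pairwise r := List.pairwise_insertionSort r _
  have hinj : Function.Injective fun i : Fin N => L.get (i.cast hlen.symm) := by
    intro i j hij
    simpa using List.nodup_iff_injective_get.1 hnodup hij
  refine ⟨Equiv.ofBijective _ (Finite.injective_iff_bijective.1 hinj), ?_, ?_⟩
  · intro i j hij
    rcases hij.eq_or_lt with rfl | hlt
    · exact le_rfl
    · exact List.pairwise_iff_get.1 hsort (i.cast hlen.symm) (j.cast hlen.symm) hlt
  · refine List.ext_get (by simp [hlen]) ?_
    intro n h1 h2
    simp

/-- The initial segments cut out by a monotone key have the expected length. -/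
theorem lt_iff_lt_card_of_monotone {N : ℕ} {key : Fin N → ℕ} {σ : Equiv.Perm (Fin N)}
    (h : Monotone (key ∘ σ)) (c : ℕ) (i : Fin N) :
    key (σ i) < c ↔ (i : ℕ) < (univ.filter fun n => key n < c).card := by
  have hcard : (univ.filter fun n => key n < c).card =
      (univ.filter fun n => key (σ n) < c).card :=
    (card_equiv σ (by simp)).symm
  rw [hcard]
  constructor
  · intro hi
    calc (i : ℕ) < (Finset.Iic i).card := by simp
      _ ≤ _ := card_le_card fun j hj => by
        simpa using (h (mem_Iic.1 hj)).trans_lt hi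
  · intro hi
    by_contra hcon
    refine hi.not_ge ?_
    calc _ ≤ (Finset.Iio i).card := card_le_card fun j hj => by
          by_contra hij
          rw [mem_Iio, not_lt] at hij
          exact hcon ((h hij).trans_lt (by simpa using hj))
      _ = i := by simp

open scoped NNReal in
/-- The total benefit as a function of the aggregate offloading state. -/
noncomputable def benefit (T : ℕ) (f : ℕ → ℝ → ℝ) (x : ℕ → ℝ≥0) : ℝ :=
  ∑ t ∈ range T, f t (x t)

theorem incrementsBounded_benefit {T : ℕ} {f : ℕ → ℝ → ℝ}
    (hf : ∀ t, t < T → MonotoneOn (f t) (Set.Ici (0 : ℝ)) ∧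
      ConcaveOn ℝ (Set.Ici (0 : ℝ)) (f t) ∧ f t 0 = 0) :
    IncrementsBounded (benefit T f) (benefit T f) := by
  intro x y
  simp only [benefit, ← sum_add_distrib]
  constructor
  · refine sum_le_sum fun t ht => ?_
    exact (hf t (mem_range.1 ht)).1 (x t).2 ((x + y) t).2 (by simp)
  · refine sum_le_sum fun t ht => ?_
    obtain ⟨-, hc, h0⟩ := hf t (mem_range.1 ht)
    simpa using hc.map_add_le_of_map_zero_s12 h0 (x t).2 (y t).2

theorem Waux_eq_sequenceValue (T N : ℕ) (f : ℕ → ℝ → ℝ) (X : ℕ → ℕ → ℝ) (Q : ℕ → ℝ)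
    (hX : ∀ n, n < N → ∀ t, t < T → 0 ≤ X n t) (j : ℕ) (hj : j ≤ N) (b : ℕ → Bool)
    (hb : ∀ n, N - j ≤ n → b n = false) :
    Waux T N f X Q j b = sequenceValue Q (fun n t => (X n t).toNNReal) (benefit T f)
      (List.range' (N - j) j) (∑ n ∈ range N, if b n then fun t => (X n t).toNNReal else 0) := by
  induction j generalizing b with
  | zero =>
    simp only [Waux, socialOffload, List.range'_zero, sequenceValue, List.foldr_nil, benefit]
    refine sum_congr rfl fun t ht => ?_
    congr 1
    rw [Finset.sum_apply, NNReal.coe_sum]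
    refine sum_congr rfl fun n hn => ?_
    split_ifs
    · exact (Real.coe_toNNReal _ (hX n (mem_range.1 hn) t (mem_range.1 ht))).symm
    · simp
  | succ j ih =>
    have hk : N - (j + 1) + 1 = N - j := by omega
    have hmem : N - (j + 1) ∈ range N := mem_range.2 (by omega)
    have hfalse : Function.update b (N - (j + 1)) false = b := by
      rw [← hb _ le_rfl, Function.update_eq_self]
    have hstate : (∑ n ∈ range N, if Function.update b (N - (j + 1)) true n
          then fun t => (X n t).toNNReal else 0) =
        (∑ n ∈ range N, if b n then fun t => (X n t).toNNReal else 0) +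
          fun t => (X (N - (j + 1)) t).toNNReal := by
      rw [← add_sum_erase _ _ hmem, ← add_sum_erase (range N) (fun n => if b n then _ else 0) hmem]
      simp only [Function.update_self, hb _ le_rfl, if_true, Bool.false_eq_true, if_false, zero_add]
      rw [add_comm]
      congr 1
      refine sum_congr rfl fun n hn => ?_
      rw [Function.update_of_ne (ne_of_mem_erase hn)]
    rw [Waux, hfalse, ih (by omega) b (fun n hn => hb n (by omega)),
      ih (by omega) _ (fun n hn => by
        rw [Function.update_of_ne (by omega)]
        exact hb n (by omega)),
      hstate, List.range'_succ, hk]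
    rfl

theorem U0perm_eq_sequenceValue (T N : ℕ) (f : ℕ → ℝ → ℝ) (X : ℕ → ℕ → ℝ) (Q : ℕ → ℝ)
    (hX : ∀ n, n < N → ∀ t, t < T → 0 ≤ X n t) (σ : Equiv.Perm (Fin N)) :
    U0perm T N f X Q σ = sequenceValue (fun i : Fin N => Q i)
      (fun i t => (X i t).toNNReal) (benefit T f) (List.ofFn σ) 0 := by
  rw [U0perm, W, Waux_eq_sequenceValue _ _ _ _ _ _ _ (by omega) _ (by simp)]
  · simp only [Nat.sub_zero, Nat.sub_self, Bool.false_eq_true, if_false, sum_const_zero,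
      sequenceValue, ← List.range_eq_range', ← List.map_coe_finRange_eq_range, List.ofFn_eq_map,
      List.foldr_map, permQ, permX, Fin.is_lt, dite_true, Fin.eta]
  · intro n hn t ht
    simp only [permX, hn, dite_true]
    exact hX _ (σ ⟨n, hn⟩).2 t ht

theorem card_filter_range_eq_univ (N : ℕ) (p : ℕ → Prop) [DecidablePred p] :
    ((range N).filter p).card = (univ.filter fun i : Fin N => p i).card := by
  rw [← Nat.Iio_eq_range, ← Fin.map_valEmbedding_univ, filter_map, card_map]
  rfl

/-- Theorem 1, existence part: there is an optimal bargaining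
sequence whose first `N₁` positions hold type-1 VOs and whose last `N₃`
positions hold type-3 VOs. -/
theorem exists_structured_optimal_sequence (T N : ℕ) (hT : 1 ≤ T) (hN : 1 ≤ N)
    (f : ℕ → ℝ → ℝ) (X : ℕ → ℕ → ℝ) (Q : ℕ → ℝ)
    (hf : ∀ t, t < T → MonotoneOn (f t) (Set.Ici (0 : ℝ)) ∧
      ConcaveOn ℝ (Set.Ici (0 : ℝ)) (f t) ∧ f t 0 = 0)
    (hX : ∀ n, n < N → ∀ t, t < T → 0 ≤ X n t) :
    ∃ σ : Equiv.Perm (Fin N),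
      (∀ τ : Equiv.Perm (Fin N), U0perm T N f X Q τ ≤ U0perm T N f X Q σ) ∧
      (∀ i : Fin N, (i : ℕ) < numType1 N Q → 0 ≤ Q ((σ i : Fin N) : ℕ)) ∧
      (∀ i : Fin N, numType1 N Q + numType2 T N f X Q ≤ (i : ℕ) →
        (∑ t ∈ range T, f t (X ((σ i : Fin N) : ℕ) t)) + Q ((σ i : Fin N) : ℕ) < 0) := by
  classical
  set q : Fin N → ℝ := fun i => Q i
  set y : Fin N → ℕ → NNReal := fun i t => (X i t).toNNReal
  set key := voType q y (benefit T f) with hkey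
  have hG := incrementsBounded_benefit hf
  have hy : ∀ i : Fin N, benefit T f (y i) = ∑ t ∈ range T, f t (X i t) := fun i =>
    sum_congr rfl fun t ht => by
      rw [Real.coe_toNNReal _ (hX i i.2 t (mem_range.1 ht))]
  have hpos : ∀ i : Fin N, 0 ≤ ∑ t ∈ range T, f t (X i t) := fun i =>
    sum_nonneg fun t ht => by
      obtain ⟨hm, -, h0⟩ := hf t (mem_range.1 ht)
      have hXi := hX i i.2 t (mem_range.1 ht)
      simpa [h0] using hm (Set.mem_Ici.2 le_rfl) (Set.mem_Ici.2 hXi) hXi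
  have key1 : ∀ i, key i < 1 ↔ 0 ≤ Q i := by
    intro i
    simp only [hkey, voType, q]
    split_ifs <;> simp_all
  have key2 : ∀ i : Fin N, key i < 2 ↔ 0 ≤ (∑ t ∈ range T, f t (X i t)) + Q i := by
    intro i
    have := hpos i
    simp only [hkey, voType, hy, q]
    split_ifs with h1 h2
    · exact iff_of_true (by norm_num) (add_nonneg this h1)
    · exact iff_of_true (by norm_num) h2
    · exact iff_of_false (by norm_num) h2
  have card1 : numType1 N Q = (univ.filter fun i => key i < 1).card := by
    rw [numType1, card_filter_range_eq_univ]
    simp only [key1]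
  have card2 : numType1 N Q + numType2 T N f X Q = (univ.filter fun i => key i < 2).card := by
    rw [numType1, numType2, card_filter_range_eq_univ, card_filter_range_eq_univ,
      ← card_union_of_disjoint, ← filter_or]
    · congr 1
      refine filter_congr fun i _ => ?_
      rw [key2]
      have := hpos i
      constructor
      · rintro (h | h)
        · exact add_nonneg this h
        · exact h.2
      · intro h
        exact (le_or_gt 0 (Q i)).imp_right fun h' => ⟨h', h⟩
    · exact disjoint_filter.2 fun i _ h h' => h.not_gt h'.1
  obtain ⟨τ, hτ⟩ := Finite.exists_max (U0perm T N f X Q)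
  obtain ⟨σ, hmono, hσ⟩ := exists_perm_ofFn_eq_insertionSort key τ
  refine ⟨σ, fun ρ => (hτ ρ).trans ?_, fun i hi => ?_, fun i hi => ?_⟩
  · rw [U0perm_eq_sequenceValue _ _ _ _ _ hX, U0perm_eq_sequenceValue _ _ _ _ _ hX, hσ]
    exact sequenceValue_le_insertionSort hG q y _ 0
  · rw [card1, ← lt_iff_lt_card_of_monotone hmono] at hi
    exact (key1 _).1 hi
  · rw [card2, ← not_lt, ← lt_iff_lt_card_of_monotone hmono, key2, not_le] at hi
    exact hi
end

section
/- Suppose the VOs are sorted: Q_1 ≥ Q_2 ≥ … ≥ Q_N and X_1^t ≥ X_2^t ≥ … ≥ X_N^t for every t ∈ {1,…,T}. Then the identity bargaining sequence is optimal: U_0 = W_0 ≥ U_0^σ for every permutation σ of {1,…,N}. -/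
open Finset

/-- Value of bargaining successively with the VOs in a list, starting from the vector `x` of
volumes already offloaded. -/
noncomputable def listValue {ι : Type*} (T : ℕ) (f : ℕ → ℝ → ℝ) (X : ι → ℕ → ℝ) (Q : ι → ℝ) :
    List ι → (ℕ → ℝ) → ℝ
  | [], x => ∑ t ∈ range T, f t (x t)
  | n :: l, x =>
      (1 / 2) * listValue T f X Q l x
        + (1 / 2) * max (listValue T f X Q l x) (listValue T f X Q l (x + X n) + Q n)

theorem listValue_map {ι κ : Type*} (T : ℕ) (f : ℕ → ℝ → ℝ) (X : ι → ℕ → ℝ) (Q : ι → ℝ)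
    (g : κ → ι) (l : List κ) (x : ℕ → ℝ) :
    listValue T f X Q (l.map g) x = listValue T f (X ∘ g) (Q ∘ g) l x := by
  induction l generalizing x with
  | nil => rfl
  | cons n l ih => simp [listValue, ih]

section Monotone

variable {ι : Type*} {T : ℕ} {f : ℕ → ℝ → ℝ} {X : ι → ℕ → ℝ} {Q : ι → ℝ}

theorem listValue_mono (hf : ∀ t < T, MonotoneOn (f t) (Set.Ici 0))
    (hX : ∀ n, ∀ t < T, 0 ≤ X n t) (l : List ι) {x y : ℕ → ℝ}
    (hx : ∀ t < T, 0 ≤ x t) (hxy : ∀ t < T, x t ≤ y t) :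
    listValue T f X Q l x ≤ listValue T f X Q l y := by
  induction l generalizing x y with
  | nil =>
    refine sum_le_sum fun t ht => ?_
    have ht := mem_range.1 ht
    exact hf t ht (hx t ht) ((hx t ht).trans (hxy t ht)) (hxy t ht)
  | cons n l ih =>
    have h₁ := ih hx hxy
    have h₂ : listValue T f X Q l (x + X n) ≤ listValue T f X Q l (y + X n) :=
      ih (fun t ht => add_nonneg (hx t ht) (hX n t ht))
        (fun t ht => add_le_add_left (hxy t ht) _)
    simp only [listValue]
    gcongr

theorem listValue_cons_le_cons (hX : ∀ n, ∀ t < T, 0 ≤ X n t) (n : ι) {l l' : List ι}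
    (h : ∀ x : ℕ → ℝ, (∀ t < T, 0 ≤ x t) → listValue T f X Q l x ≤ listValue T f X Q l' x)
    {x : ℕ → ℝ} (hx : ∀ t < T, 0 ≤ x t) :
    listValue T f X Q (n :: l) x ≤ listValue T f X Q (n :: l') x := by
  have h₁ := h x hx
  have h₂ := h (x + X n) fun t ht => add_nonneg (hx t ht) (hX n t ht)
  simp only [listValue]
  gcongr

/-- Bargaining first with the VO having the larger `Q` and `X` is at least as good. -/
theorem listValue_swap_le (hf : ∀ t < T, MonotoneOn (f t) (Set.Ici 0))
    (hX : ∀ n, ∀ t < T, 0 ≤ X n t) {m n : ι} (hQ : Q n ≤ Q m)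
    (hmn : ∀ t < T, X n t ≤ X m t) (l : List ι) {x : ℕ → ℝ} (hx : ∀ t < T, 0 ≤ x t) :
    listValue T f X Q (n :: m :: l) x ≤ listValue T f X Q (m :: n :: l) x := by
  have h : listValue T f X Q l (x + X n) ≤ listValue T f X Q l (x + X m) :=
    listValue_mono hf hX l (fun t ht => add_nonneg (hx t ht) (hX n t ht))
      (fun t ht => add_le_add_right (hmn t ht) _)
  simp only [listValue, add_right_comm x (X n) (X m)]
  generalize listValue T f X Q l x = v₀ at *
  generalize listValue T f X Q l (x + X n) = v₁ at *
  generalize listValue T f X Q l (x + X m) = v₂ at *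
  generalize listValue T f X Q l (x + X m + X n) = v₃ at *
  grind

variable [LinearOrder ι]

theorem listValue_cons_le_orderedInsert (hf : ∀ t < T, MonotoneOn (f t) (Set.Ici 0))
    (hX : ∀ n, ∀ t < T, 0 ≤ X n t) (hQ : Antitone Q)
    (hXs : ∀ t < T, Antitone fun n => X n t) (n : ι) (l : List ι) {x : ℕ → ℝ}
    (hx : ∀ t < T, 0 ≤ x t) :
    listValue T f X Q (n :: l) x ≤ listValue T f X Q (l.orderedInsert (· ≤ ·) n) x := by
  induction l generalizing x with
  | nil => exact le_rfl
  | cons m l ih =>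
    rw [List.orderedInsert]
    split_ifs with hnm
    · exact le_rfl
    · have hmn : m ≤ n := (not_le.1 hnm).le
      exact (listValue_swap_le hf hX (hQ hmn) (fun t ht => hXs t ht hmn) l hx).trans
        (listValue_cons_le_cons hX m (fun y hy => ih hy) hx)

theorem listValue_le_insertionSort (hf : ∀ t < T, MonotoneOn (f t) (Set.Ici 0))
    (hX : ∀ n, ∀ t < T, 0 ≤ X n t) (hQ : Antitone Q)
    (hXs : ∀ t < T, Antitone fun n => X n t) (l : List ι) {x : ℕ → ℝ}
    (hx : ∀ t < T, 0 ≤ x t) :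
    listValue T f X Q l x ≤ listValue T f X Q (l.insertionSort (· ≤ ·)) x := by
  induction l generalizing x with
  | nil => exact le_rfl
  | cons n l ih =>
    exact (listValue_cons_le_cons hX n (fun y hy => ih hy) hx).trans
      (listValue_cons_le_orderedInsert hf hX hQ hXs n _ hx)

end Monotone

theorem Waux_eq_listValue (T N : ℕ) (f : ℕ → ℝ → ℝ) (X : ℕ → ℕ → ℝ) (Q : ℕ → ℝ) (j : ℕ)
    (hj : j ≤ N) (b : ℕ → Bool) :
    Waux T N f X Q j b = listValue T f X Q (List.range' (N - j) j)
      (fun t => ∑ n ∈ range (N - j), if b n then X n t else 0) := by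
  induction j generalizing b with
  | zero => rfl
  | succ j ih =>
    have hk : N - j = N - (j + 1) + 1 := by omega
    have hsum (c : Bool) (t : ℕ) :
        (∑ n ∈ range (N - (j + 1)),
          if Function.update b (N - (j + 1)) c n then X n t else 0) =
        ∑ n ∈ range (N - (j + 1)), if b n then X n t else 0 := by
      refine sum_congr rfl fun n hn => ?_
      rw [Function.update_of_ne (mem_range.1 hn).ne]
    simp only [Waux, ih (by omega), List.range'_succ, listValue, hk, sum_range_succ, hsum,
      Function.update_self]
    simp [Pi.add_def]

theorem W_zero_eq_listValue (T N : ℕ) (f : ℕ → ℝ → ℝ) (X : ℕ → ℕ → ℝ) (Q : ℕ → ℝ)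
    (b : ℕ → Bool) :
    W T N f X Q 0 b =
      listValue T f (fun n : Fin N => X n) (fun n : Fin N => Q n) (List.finRange N) 0 := by
  have h := listValue_map T f X Q (Fin.val : Fin N → ℕ) (List.finRange N) 0
  rw [List.map_coe_finRange_eq_range, List.range_eq_range'] at h
  rw [W, Nat.sub_zero, Waux_eq_listValue T N f X Q N le_rfl]
  simp only [Nat.sub_self, range_zero, sum_empty]
  exact h

theorem U0perm_eq_listValue (T N : ℕ) (f : ℕ → ℝ → ℝ) (X : ℕ → ℕ → ℝ) (Q : ℕ → ℝ)
    (σ : Equiv.Perm (Fin N)) :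
    U0perm T N f X Q σ =
      listValue T f (fun n : Fin N => X n) (fun n : Fin N => Q n)
        ((List.finRange N).map σ) 0 := by
  rw [U0perm, W_zero_eq_listValue, listValue_map]
  congr 1
  · funext n t
    simp [permX]
  · funext n
    simp [permQ]

theorem antitone_fin_of_succ_le {N : ℕ} {a : ℕ → ℝ} (ha : ∀ n, n + 1 < N → a (n + 1) ≤ a n) :
    Antitone fun n : Fin N => a n := by
  intro m n hmn
  have key : ∀ k, m + k < N → a (m + k) ≤ a m := by
    intro k
    induction k with
    | zero => simp
    | succ k ih => exact fun hk => (ha _ hk).trans (ih (by omega))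
  have := key (n - m) (by omega)
  rwa [Nat.add_sub_cancel' hmn] at this

/-- Theorem 4(i): if the VOs are sorted (`Q_1 ≥ … ≥ Q_N` and
`X_1^t ≥ … ≥ X_N^t` for every `t`), the identity bargaining sequence is optimal:
`U_0 = W_0 ≥ U_0^σ` for every permutation `σ`. -/
theorem sorted_identity_optimal (T N : ℕ) (hT : 1 ≤ T) (hN : 1 ≤ N)
    (f : ℕ → ℝ → ℝ) (X : ℕ → ℕ → ℝ) (Q : ℕ → ℝ)
    (hf : ∀ t, t < T → MonotoneOn (f t) (Set.Ici (0 : ℝ)) ∧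
      ConcaveOn ℝ (Set.Ici (0 : ℝ)) (f t) ∧ f t 0 = 0)
    (hX : ∀ n, n < N → ∀ t, t < T → 0 ≤ X n t)
    (hQs : ∀ n, n + 1 < N → Q (n + 1) ≤ Q n)
    (hXs : ∀ n, n + 1 < N → ∀ t, t < T → X (n + 1) t ≤ X n t) :
    ∀ σ : Equiv.Perm (Fin N),
      U0perm T N f X Q σ ≤ W T N f X Q 0 (fun _ => false) := by
  intro σ
  have hQ : Antitone fun n : Fin N => Q n := antitone_fin_of_succ_le hQs
  have hXa : ∀ t < T, Antitone fun n : Fin N => X n t := fun t ht =>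
    antitone_fin_of_succ_le (a := fun n => X n t) fun n hn => hXs n hn t ht
  have hsort : ((List.finRange N).map σ).insertionSort (· ≤ ·) = List.finRange N :=
    ((List.perm_insertionSort _ _).trans (Equiv.Perm.map_finRange_perm σ)).eq_of_pairwise'
      (List.pairwise_insertionSort _ _) (List.pairwise_le_finRange N)
  have h := listValue_le_insertionSort (f := f) (X := fun n : Fin N => X n)
    (fun t ht => (hf t ht).1) (fun n t ht => hX n n.isLt t ht) hQ hXa ((List.finRange N).map σ) (x := 0)
    (fun _ _ => le_rfl)
  rw [hsort] at h
  rwa [U0perm_eq_listValue, W_zero_eq_listValue]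
end

section
/- Suppose the VOs are sorted: Q_1 ≥ Q_2 ≥ … ≥ Q_N and X_1^t ≥ X_2^t ≥ … ≥ X_N^t for every t ∈ {1,…,T}. Then there exists a unique k ∈ {0,1,…,N} such that (a) if k ≥ 1 then Σ_{t=1}^T [f_t(Σ_{n=1}^k X_n^t) − f_t(Σ_{n=1}^{k−1} X_n^t)] + Q_k ≥ 0, and (b) if k ≤ N−1 then Σ_{t=1}^T [f_t(Σ_{n=1}^{k+1} X_n^t) − f_t(Σ_{n=1}^k X_n^t)] + Q_{k+1} < 0; moreover, the realized bargaining outcomes satisfy b̂_n = 1 for every n ≤ k and b̂_n = 0 for every n > k, i.e. the MNO cooperates with exactly the first k VOs. -/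
open Finset

/-- The offloading benefit at the accumulated traffic vector `x`. -/
noncomputable def offloadBenefit (T : ℕ) (f : ℕ → ℝ → ℝ) (x : ℕ → ℝ) : ℝ :=
  ∑ t ∈ range T, f t (x t)

/-- The value function with `j` remaining bargaining steps, as a function of the
accumulated traffic vector. -/
noncomputable def trafficValue (T N : ℕ) (f : ℕ → ℝ → ℝ) (X : ℕ → ℕ → ℝ) (Q : ℕ → ℝ) :
    ℕ → (ℕ → ℝ) → ℝ
  | 0, x => offloadBenefit T f x
  | j + 1, x =>
      (1 / 2) * trafficValue T N f X Q j x
        + (1 / 2) * max (trafficValue T N f X Q j x)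
            (trafficValue T N f X Q j (x + X (N - (j + 1))) + Q (N - (j + 1)))

theorem ConcaveOn.add_add_le_of_nonneg {g : ℝ → ℝ} (hg : ConcaveOn ℝ (Set.Ici (0 : ℝ)) g)
    {x y z : ℝ} (hx : 0 ≤ x) (hy : 0 ≤ y) (hz : 0 ≤ z) :
    g (x + y + z) + g x ≤ g (x + y) + g (x + z) := by
  rcases (add_nonneg hy hz).eq_or_lt with h | h
  · obtain rfl : y = 0 := by linarith
    obtain rfl : z = 0 := by linarith
    simp
  have hs : y / (y + z) + z / (y + z) = 1 := by field_simp
  have hyz : x + y + z ∈ Set.Ici (0 : ℝ) := by simp only [Set.mem_Ici]; positivity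
  have h₁ := hg.2 hyz (Set.mem_Ici.2 hx) (by positivity) (by positivity) hs
  have h₂ := hg.2 (Set.mem_Ici.2 hx) hyz (by positivity) (by positivity) hs
  have e₁ : (y / (y + z)) * (x + y + z) + (z / (y + z)) * x = x + y := by field_simp; ring
  have e₂ : (y / (y + z)) * x + (z / (y + z)) * (x + y + z) = x + z := by field_simp; ring
  simp only [smul_eq_mul, e₁, e₂] at h₁ h₂
  linear_combination h₁ + h₂ - (g (x + y + z) + g x) * hs

theorem existsUnique_threshold {N : ℕ} {D : ℕ → ℝ}
    (hD : ∀ m n, m ≤ n → n < N → D n ≤ D m) :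
    ∃! k, k ≤ N ∧ (1 ≤ k → 0 ≤ D (k - 1)) ∧ (k < N → D k < 0) := by
  classical
  have hex : ∃ k, k < N → D k < 0 := ⟨N, fun h => (lt_irrefl _ h).elim⟩
  refine ⟨Nat.find hex, ⟨Nat.find_min' hex fun h => (lt_irrefl _ h).elim, fun h => ?_,
    Nat.find_spec hex⟩, ?_⟩
  · have := Nat.find_min hex (m := Nat.find hex - 1) (by omega)
    push Not at this
    exact this.2
  · rintro k ⟨hk, hpos, hneg⟩
    refine le_antisymm ?_ (Nat.find_min' hex hneg)
    by_contra! hlt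
    have h₁ := Nat.find_spec hex (by omega)
    have h₂ := hpos (by omega)
    have h₃ := hD (Nat.find hex) (k - 1) (by omega) (by omega)
    linarith

section TrafficValue

variable {T N : ℕ} {f : ℕ → ℝ → ℝ} {X : ℕ → ℕ → ℝ} {Q : ℕ → ℝ}

theorem offloadBenefit_mono (hf : ∀ t, t < T → MonotoneOn (f t) (Set.Ici (0 : ℝ)))
    {x y : ℕ → ℝ} (hx : ∀ t, t < T → 0 ≤ x t) (hxy : ∀ t, t < T → x t ≤ y t) :
    offloadBenefit T f x ≤ offloadBenefit T f y := by
  refine sum_le_sum fun t ht => ?_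
  have ht := mem_range.1 ht
  exact hf t ht (hx t ht) ((hx t ht).trans (hxy t ht)) (hxy t ht)

theorem offloadBenefit_add_add_le
    (hf : ∀ t, t < T → ConcaveOn ℝ (Set.Ici (0 : ℝ)) (f t)) {x y z : ℕ → ℝ}
    (hx : ∀ t, t < T → 0 ≤ x t) (hy : ∀ t, t < T → 0 ≤ y t) (hz : ∀ t, t < T → 0 ≤ z t) :
    offloadBenefit T f (x + y + z) + offloadBenefit T f x
      ≤ offloadBenefit T f (x + y) + offloadBenefit T f (x + z) := by
  simp only [offloadBenefit, ← sum_add_distrib]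
  refine sum_le_sum fun t ht => ?_
  have ht := mem_range.1 ht
  exact (hf t ht).add_add_le_of_nonneg (hx t ht) (hy t ht) (hz t ht)

theorem trafficValue_le_succ (j : ℕ) (x : ℕ → ℝ) :
    trafficValue T N f X Q j x ≤ trafficValue T N f X Q (j + 1) x := by
  rw [trafficValue]
  linarith [le_max_left (trafficValue T N f X Q j x)
    (trafficValue T N f X Q j (x + X (N - (j + 1))) + Q (N - (j + 1)))]

theorem trafficValue_mono (hf : ∀ t, t < T → MonotoneOn (f t) (Set.Ici (0 : ℝ)))
    (hX : ∀ n, n < N → ∀ t, t < T → 0 ≤ X n t) {j : ℕ} (hj : j ≤ N)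
    {x y : ℕ → ℝ} (hx : ∀ t, t < T → 0 ≤ x t) (hxy : ∀ t, t < T → x t ≤ y t) :
    trafficValue T N f X Q j x ≤ trafficValue T N f X Q j y := by
  induction j generalizing x y with
  | zero => exact offloadBenefit_mono hf hx hxy
  | succ j ih =>
    have h₁ := ih (by omega) hx hxy
    have h₂ := ih (by omega) (x := x + X (N - (j + 1))) (y := y + X (N - (j + 1)))
      (fun t ht => add_nonneg (hx t ht) (hX _ (by omega) t ht))
      (fun t ht => add_le_add_left (hxy t ht) _)
    simp only [trafficValue]
    gcongr

theorem trafficValue_marginal_nonneg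
    (hf : ∀ t, t < T → MonotoneOn (f t) (Set.Ici (0 : ℝ)))
    (hX : ∀ n, n < N → ∀ t, t < T → 0 ≤ X n t) {j : ℕ} (hj : j ≤ N)
    {x Y : ℕ → ℝ} {q : ℝ} (hx : ∀ t, t < T → 0 ≤ x t)
    (hY : ∀ n, N - j ≤ n → n < N → ∀ t, t < T → X n t ≤ Y t)
    (hq : ∀ n, N - j ≤ n → n < N → Q n ≤ q)
    (h : 0 ≤ offloadBenefit T f (x + Y) - offloadBenefit T f x + q) :
    0 ≤ trafficValue T N f X Q j (x + Y) - trafficValue T N f X Q j x + q := by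
  induction j with
  | zero => exact h
  | succ j ih =>
    have h₁ := ih (by omega) (fun n hn => hY n (by omega)) (fun n hn => hq n (by omega))
    have h₂ := trafficValue_mono (Q := Q) hf hX (j := j) (by omega)
      (x := x + X (N - (j + 1))) (y := x + Y)
      (fun t ht => add_nonneg (hx t ht) (hX _ (by omega) t ht))
      (fun t ht => add_le_add_right (hY _ le_rfl (by omega) t ht) _)
    have h₃ := hq (N - (j + 1)) le_rfl (by omega)
    have h₄ := trafficValue_le_succ (T := T) (N := N) (f := f) (X := X) (Q := Q) j (x + Y)
    have h₅ : max (trafficValue T N f X Q j x)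
        (trafficValue T N f X Q j (x + X (N - (j + 1))) + Q (N - (j + 1)))
        ≤ trafficValue T N f X Q j (x + Y) + q := max_le (by linarith) (by linarith)
    have h₆ : trafficValue T N f X Q (j + 1) x = (1 / 2) * trafficValue T N f X Q j x
        + (1 / 2) * max (trafficValue T N f X Q j x)
          (trafficValue T N f X Q j (x + X (N - (j + 1))) + Q (N - (j + 1))) := rfl
    linarith

theorem trafficValue_eq_offloadBenefit
    (hf : ∀ t, t < T → ConcaveOn ℝ (Set.Ici (0 : ℝ)) (f t))
    (hX : ∀ n, n < N → ∀ t, t < T → 0 ≤ X n t) {j : ℕ} (hj : j ≤ N)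
    {x : ℕ → ℝ} (hx : ∀ t, t < T → 0 ≤ x t)
    (h : ∀ n, N - j ≤ n → n < N →
      offloadBenefit T f (x + X n) - offloadBenefit T f x + Q n ≤ 0) :
    trafficValue T N f X Q j x = offloadBenefit T f x := by
  induction j generalizing x with
  | zero => rfl
  | succ j ih =>
    have hm : N - (j + 1) < N := by omega
    have h₁ := ih (by omega) hx fun n hn => h n (by omega)
    have h₂ := ih (by omega) (x := x + X (N - (j + 1)))
      (fun t ht => add_nonneg (hx t ht) (hX _ hm t ht)) fun n hn hnN => by
        linarith [offloadBenefit_add_add_le hf hx (hX _ hm) (hX n hnN), h n (by omega) hnN]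
    have h₃ := h _ le_rfl hm
    rw [trafficValue, h₁, h₂, max_eq_left (by linarith)]
    ring

/-- The traffic accumulated from the first `k` operators under the outcomes `b`. -/
def prefixTraffic (X : ℕ → ℕ → ℝ) (b : ℕ → Bool) (k : ℕ) (t : ℕ) : ℝ :=
  ∑ n ∈ range k, if b n then X n t else 0

theorem prefixTraffic_update_succ (b : ℕ → Bool) (k : ℕ) (c : Bool) :
    prefixTraffic X (Function.update b k c) (k + 1)
      = if c then prefixTraffic X b k + X k else prefixTraffic X b k := by
  have h (t : ℕ) : (∑ n ∈ range k, if Function.update b k c n then X n t else 0)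
      = ∑ n ∈ range k, if b n then X n t else 0 :=
    sum_congr rfl fun n hn => by rw [Function.update_of_ne (mem_range.1 hn).ne]
  ext t
  cases c <;> simp [prefixTraffic, sum_range_succ, h]

theorem Waux_eq_trafficValue {j : ℕ} (hj : j ≤ N) (b : ℕ → Bool) :
    Waux T N f X Q j b = trafficValue T N f X Q j (prefixTraffic X b (N - j)) := by
  induction j generalizing b with
  | zero => rfl
  | succ j ih =>
    have hs : N - j = N - (j + 1) + 1 := by omega
    simp only [Waux, trafficValue, ih (by omega : j ≤ N), hs, prefixTraffic_update_succ]
    simp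

theorem Delta_eq_trafficValue {k : ℕ} (hk : k < N) (b : ℕ → Bool) :
    Delta T N f X Q k b
      = trafficValue T N f X Q (N - (k + 1)) (prefixTraffic X b k + X k)
        - trafficValue T N f X Q (N - (k + 1)) (prefixTraffic X b k) + Q k := by
  have hs : N - (N - (k + 1)) = k + 1 := by omega
  simp [Delta, W, Waux_eq_trafficValue, hs, prefixTraffic_update_succ]

theorem prefixTraffic_threshold {m k : ℕ} {b : ℕ → Bool}
    (hb : ∀ n, b n = decide (n < k ∧ n < m)) :
    prefixTraffic X b m = fun t => ∑ n ∈ range (min k m), X n t := by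
  ext t
  simp only [prefixTraffic, hb, decide_eq_true_eq, ← sum_filter]
  congr 1
  ext n
  simp

/-- If the marginal surplus of the last accepted operator is nonnegative and that of the
next one is negative, the realized outcomes are the indicator of the first `k` operators. -/
theorem bhatFn_eq_threshold
    (hm : ∀ t, t < T → MonotoneOn (f t) (Set.Ici (0 : ℝ)))
    (hc : ∀ t, t < T → ConcaveOn ℝ (Set.Ici (0 : ℝ)) (f t))
    (hX : ∀ n, n < N → ∀ t, t < T → 0 ≤ X n t)
    (hQs : ∀ m n, m ≤ n → n < N → Q n ≤ Q m)
    (hXs : ∀ m n, m ≤ n → n < N → ∀ t, t < T → X n t ≤ X m t) {k : ℕ} (hk : k ≤ N)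
    (hpos : ∀ n, n < k → 0 ≤ offloadBenefit T f (fun t => ∑ i ∈ range (n + 1), X i t)
      - offloadBenefit T f (fun t => ∑ i ∈ range n, X i t) + Q n)
    (hneg : k < N → offloadBenefit T f (fun t => ∑ i ∈ range (k + 1), X i t)
      - offloadBenefit T f (fun t => ∑ i ∈ range k, X i t) + Q k < 0)
    {m : ℕ} (hmN : m ≤ N) (n : ℕ) :
    bhatFn T N f X Q m n = decide (n < k ∧ n < m) := by
  have hS (l : ℕ) : (fun t => ∑ i ∈ range (l + 1), X i t)
      = (fun t => ∑ i ∈ range l, X i t) + X l := by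
    ext t; simp [sum_range_succ]
  have hS0 (l : ℕ) (hl : l ≤ N) (t : ℕ) (ht : t < T) : 0 ≤ ∑ i ∈ range l, X i t :=
    sum_nonneg fun i hi => hX i ((mem_range.1 hi).trans_le hl) t ht
  induction m generalizing n with
  | zero => simp [bhatFn]
  | succ m ih =>
    have ih := ih (by omega)
    have hstep : 0 ≤ Delta T N f X Q m (bhatFn T N f X Q m) ↔ m < k := by
      rw [Delta_eq_trafficValue (by omega), prefixTraffic_threshold ih]
      rcases lt_or_ge m k with hmk | hkm
      · rw [min_eq_right hmk.le]
        refine iff_of_true (trafficValue_marginal_nonneg hm hX (by omega) (hS0 m (by omega))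
          (fun n hn hnN => hXs m n (by omega) hnN) (fun n hn hnN => hQs m n (by omega) hnN)
          ?_) hmk
        rw [← hS]
        exact hpos m hmk
      · rw [min_eq_left hkm]
        have hx := hS0 k hk
        set x : ℕ → ℝ := fun t => ∑ i ∈ range k, X i t
        have hlt (n : ℕ) (hn : k ≤ n) (hnN : n < N) :
            offloadBenefit T f (x + X n) - offloadBenefit T f x + Q n < 0 := by
          have h₁ := hneg (by omega)
          rw [hS] at h₁
          have h₂ := offloadBenefit_mono hm (x := x + X n) (y := x + X k)
            (fun t ht => add_nonneg (hx t ht) (hX n hnN t ht))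
            (fun t ht => add_le_add_right (hXs k n hn hnN t ht) _)
          linarith [hQs k n hn hnN]
        have hXm := hX m (by omega)
        rw [trafficValue_eq_offloadBenefit hc hX (by omega) (x := x) hx
            fun n hn hnN => (hlt n (by omega) hnN).le,
          trafficValue_eq_offloadBenefit hc hX (by omega) (x := x + X m)
            (fun t ht => add_nonneg (hx t ht) (hXm t ht))
            fun n hn hnN => by
              linarith [offloadBenefit_add_add_le hc hx hXm (hX n hnN), hlt n (by omega) hnN]]
        exact iff_of_false (not_le.2 (hlt m hkm (by omega))) (by omega)
    rw [bhatFn]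
    rcases eq_or_ne n m with rfl | hne
    · simp [hstep]
    · rw [Function.update_of_ne hne, ih]
      congr 1
      apply propext
      omega

theorem marginal_antitone
    (hm : ∀ t, t < T → MonotoneOn (f t) (Set.Ici (0 : ℝ)))
    (hc : ∀ t, t < T → ConcaveOn ℝ (Set.Ici (0 : ℝ)) (f t))
    (hX : ∀ n, n < N → ∀ t, t < T → 0 ≤ X n t)
    (hQs : ∀ n, n + 1 < N → Q (n + 1) ≤ Q n)
    (hXs : ∀ n, n + 1 < N → ∀ t, t < T → X (n + 1) t ≤ X n t) (n : ℕ) (hn : n + 1 < N) :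
    offloadBenefit T f (fun t => ∑ i ∈ range (n + 1 + 1), X i t)
        - offloadBenefit T f (fun t => ∑ i ∈ range (n + 1), X i t) + Q (n + 1)
      ≤ offloadBenefit T f (fun t => ∑ i ∈ range (n + 1), X i t)
        - offloadBenefit T f (fun t => ∑ i ∈ range n, X i t) + Q n := by
  have hS (l : ℕ) : (fun t => ∑ i ∈ range (l + 1), X i t)
      = (fun t => ∑ i ∈ range l, X i t) + X l := by
    ext t; simp [sum_range_succ]
  have hx (t : ℕ) (ht : t < T) : 0 ≤ ∑ i ∈ range n, X i t :=
    sum_nonneg fun i hi => hX i (by have := mem_range.1 hi; omega) t ht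
  rw [hS (n + 1), hS n]
  set x : ℕ → ℝ := fun t => ∑ i ∈ range n, X i t
  have h₁ := offloadBenefit_add_add_le hc hx (hX n (by omega)) (hX (n + 1) hn)
  have h₂ := offloadBenefit_mono hm (x := x + X (n + 1)) (y := x + X n)
    (fun t ht => add_nonneg (hx t ht) (hX _ hn t ht))
    (fun t ht => add_le_add_right (hXs n hn t ht) _)
  linarith [hQs n hn]

end TrafficValue

theorem le_of_forall_succ_le_of_lt {N : ℕ} {a : ℕ → ℝ}
    (ha : ∀ n, n + 1 < N → a (n + 1) ≤ a n) (m n : ℕ) (hmn : m ≤ n) (hn : n < N) :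
    a n ≤ a m := by
  induction n, hmn using Nat.le_induction with
  | base => rfl
  | succ n _ ih => exact (ha n hn).trans (ih (by omega))

/-- Theorem 4(ii): if the VOs are sorted (`Q_1 ≥ … ≥ Q_N` and
`X_1^t ≥ … ≥ X_N^t` for all `t`), there is a unique threshold `k ∈ {0,…,N}`
satisfying the two marginal inequalities, and the MNO cooperates with exactly
the first `k` VOs (0-based: `b̂_n = 1` for `n < k` and `b̂_n = 0` for `k ≤ n < N`). -/
theorem sorted_cooperation_threshold (T N : ℕ) (hT : 1 ≤ T) (hN : 1 ≤ N)
    (f : ℕ → ℝ → ℝ) (X : ℕ → ℕ → ℝ) (Q : ℕ → ℝ)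
    (hf : ∀ t, t < T → MonotoneOn (f t) (Set.Ici (0 : ℝ)) ∧
      ConcaveOn ℝ (Set.Ici (0 : ℝ)) (f t) ∧ f t 0 = 0)
    (hX : ∀ n, n < N → ∀ t, t < T → 0 ≤ X n t)
    (hQs : ∀ n, n + 1 < N → Q (n + 1) ≤ Q n)
    (hXs : ∀ n, n + 1 < N → ∀ t, t < T → X (n + 1) t ≤ X n t) :
    let P : ℕ → Prop := fun k => k ≤ N ∧
      (1 ≤ k → 0 ≤ (∑ t ∈ range T,
        (f t (∑ n ∈ range k, X n t) - f t (∑ n ∈ range (k - 1), X n t))) + Q (k - 1)) ∧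
      (k < N → (∑ t ∈ range T,
        (f t (∑ n ∈ range (k + 1), X n t) - f t (∑ n ∈ range k, X n t))) + Q k < 0)
    (∃! k : ℕ, P k) ∧
      ∀ k : ℕ, P k →
        (∀ n, n < k → bhatFn T N f X Q N n = true) ∧
        (∀ n, k ≤ n → n < N → bhatFn T N f X Q N n = false) := by
  intro P
  have hm := fun t ht => (hf t ht).1
  have hc := fun t ht => (hf t ht).2.1
  set D : ℕ → ℝ := fun n => offloadBenefit T f (fun t => ∑ i ∈ range (n + 1), X i t)
    - offloadBenefit T f (fun t => ∑ i ∈ range n, X i t) + Q n with hDdef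
  have hD := le_of_forall_succ_le_of_lt (a := D) (marginal_antitone hm hc hX hQs hXs)
  have hP (k : ℕ) : P k ↔ k ≤ N ∧ (1 ≤ k → 0 ≤ D (k - 1)) ∧ (k < N → D k < 0) := by
    simp only [P, hDdef, offloadBenefit, sum_sub_distrib]
    refine and_congr_right fun _ => and_congr_left fun _ => forall_congr' fun h => ?_
    rw [Nat.sub_add_cancel h]
  simp only [hP]
  refine ⟨existsUnique_threshold hD, fun k ⟨hk, hpos, hneg⟩ => ?_⟩
  have hb := bhatFn_eq_threshold hm hc hX (le_of_forall_succ_le_of_lt hQs)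
    (fun m n hmn hn t ht => le_of_forall_succ_le_of_lt (a := fun n => X n t)
      (fun n hn => hXs n hn t ht) m n hmn hn) hk
    (fun n hn => (hpos (by omega)).trans (hD n (k - 1) (by omega) (by omega))) hneg
    (le_refl N)
  refine ⟨fun n hn => ?_, fun n hn _ => ?_⟩
  · rw [hb, decide_eq_true_eq]
    omega
  · rw [hb, decide_eq_false_iff_not]
    omega
end
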